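/- arXiv:2512.11235 — 6 statements merged into one kernel-verified Lean document; each statement's English description precedes it below -/
import Mathlib

section
/- Let K be a finite simple graph each of whose connected components is a tree or a cycle graph. Then the obstruction map o_K : R(K, SO(3)) → {±1}^E is surjective: for every edge marking Λ : E → {±1} there exists x ∈ R(K, SO(3)) with o_K(x) = Λ. In particular, R(K, SO(3)) has at least 2^{|E|} connected components. -/
noncomputable section

/-- `SO(3)`: the space of real `3 × 3` matrices `A` with `A * Aᵀ = 1` and `det A = 1`,
topologized as a subspace of the space of matrices. -/
abbrev SO3 : Type := {A : Matrix (Fin 3) (Fin 3) ℝ // A * A.transpose = 1 ∧ A.det = 1}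

/-- The representation variety `R(K, SO(3))`: the subspace of `SO(3)^V` of tuples whose
entries commute along the edges of `K`. -/
def RepVar {V : Type*} (K : SimpleGraph V) : Set (V → SO3) :=
  {x | ∀ v w : V, K.Adj v w → (x v).1 * (x w).1 = (x w).1 * (x v).1}

/-- The identification `ℝ³ ≅ Im(ℍ)` sending `v` to the purely imaginary quaternion
`v 0 · i + v 1 · j + v 2 · k`. -/
def imQuat (v : Fin 3 → ℝ) : Quaternion ℝ := ⟨0, v 0, v 1, v 2⟩

/-- `QuatLift q x` says that the quaternion `q` is a lift of the rotation matrix `x` under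
the conjugation covering homomorphism `π : S³ → SO(3)`, i.e. conjugation by `q` on the
purely imaginary quaternions agrees with the action of `x` on `ℝ³ ≅ Im(ℍ)`. -/
def QuatLift (q : Quaternion ℝ) (x : Matrix (Fin 3) (Fin 3) ℝ) : Prop :=
  ∀ v : Fin 3 → ℝ, q * imQuat v * q⁻¹ = imQuat (x.mulVec v)

/-- `IsObstruction K x Λ` says that the edge marking `Λ` (with values in `{±1} ≅ ℤˣ`) is the
value `o_K(x)` of the obstruction map at `x`: for each edge `{v, w}` of `K` there are unit
quaternion lifts of `x v` and `x w` whose commutator is `Λ {v, w}`.  (The commutator of lifts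
is independent of the choice of lifts, so this determines `Λ` on the edges of `K`.) -/
def IsObstruction {V : Type*} (K : SimpleGraph V) (x : V → SO3) (Λ : Sym2 V → ℤˣ) : Prop :=
  ∀ v w : V, K.Adj v w → ∃ q p : Quaternion ℝ, ‖q‖ = 1 ∧ ‖p‖ = 1 ∧
    QuatLift q (x v).1 ∧ QuatLift p (x w).1 ∧
    q * p * q⁻¹ * p⁻¹ = ((Λ s(v, w) : ℤ) : Quaternion ℝ)

section Auxiliary

open scoped Quaternion

/-- Two quaternions commute up to sign. -/
def SignCommute (q p : Quaternion ℝ) : Prop := q * p = p * q ∨ q * p = -(p * q)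

namespace SignCommute

variable {q p r : Quaternion ℝ}

lemma symm (h : SignCommute q p) : SignCommute p q := by
  rcases h with h | h
  · exact Or.inl h.symm
  · exact Or.inr (by rw [h, neg_neg])

lemma neg_left (h : SignCommute q p) : SignCommute (-q) p := by
  rcases h with h | h
  · exact Or.inl (by simp [h])
  · exact Or.inr (by simp [h])

lemma refl (q : Quaternion ℝ) : SignCommute q q := Or.inl rfl

lemma conj (hr : r ≠ 0) (h : SignCommute q p) :
    SignCommute (r * q * r⁻¹) (r * p * r⁻¹) := by
  have key (a b : Quaternion ℝ) : r * a * r⁻¹ * (r * b * r⁻¹) = r * (a * b) * r⁻¹ := by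
    simp [mul_assoc, hr]
  rcases h with h | h
  · exact Or.inl (by rw [key, key, h])
  · exact Or.inr (by rw [key, key, h]; simp)

lemma of_sq_eq_one_left (h : q * q = 1) (p : Quaternion ℝ) : SignCommute q p := by
  rcases mul_self_eq_one_iff.mp h with rfl | rfl
  · exact Or.inl (by simp)
  · exact Or.inl (by simp)

lemma of_sq_eq_one_right (q : Quaternion ℝ) (h : p * p = 1) : SignCommute q p :=
  (of_sq_eq_one_left h q).symm

lemma eq_or_eq_neg_left {a : Quaternion ℝ} (h : SignCommute q p) (ha : a = q ∨ a = -q) :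
    SignCommute a p := by
  rcases ha with rfl | rfl
  exacts [h, h.neg_left]

end SignCommute

/-- Commuting square roots of `-1` agree up to sign. -/
lemma eq_or_eq_neg_of_commute {a b : Quaternion ℝ} (ha : a * a = -1) (hb : b * b = -1)
    (h : a * b = b * a) : a = b ∨ a = -b := by
  have : (a - b) * (a + b) = 0 := by
    rw [sub_mul, mul_add, mul_add, ha, hb, h]; abel
  rcases mul_eq_zero.mp this with h | h
  · exact Or.inl (sub_eq_zero.mp h)
  · exact Or.inr (eq_neg_of_add_eq_zero_left h)

lemma conj_sq {r q : Quaternion ℝ} (hr : r ≠ 0) :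
    r * q * r⁻¹ * (r * q * r⁻¹) = r * (q * q) * r⁻¹ := by
  simp [mul_assoc, hr]

lemma conj_sq_eq_neg_one {r q : Quaternion ℝ} (hr : r ≠ 0) (hq : q * q = -1) :
    r * q * r⁻¹ * (r * q * r⁻¹) = -1 := by
  simp [conj_sq hr, hq, hr]

lemma conj_of_sq_eq_one {r q : Quaternion ℝ} (hr : r ≠ 0) (hq : q * q = 1) :
    r * q * r⁻¹ = q := by
  rcases mul_self_eq_one_iff.mp hq with rfl | rfl <;> simp [hr]

/-- Squaring to `-1`, in coordinates. -/
lemma sq_eq_neg_one_iff {a : Quaternion ℝ} :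
    a * a = -1 ↔ a.re = 0 ∧ a.imI ^ 2 + a.imJ ^ 2 + a.imK ^ 2 = 1 := by
  constructor
  · intro h
    have h1 := congrArg (·.re) h
    have h2 := congrArg (·.imI) h
    have h3 := congrArg (·.imJ) h
    have h4 := congrArg (·.imK) h
    simp only [Quaternion.re_mul, Quaternion.imI_mul, Quaternion.imJ_mul, Quaternion.imK_mul,
      Quaternion.re_neg, Quaternion.imI_neg, Quaternion.imJ_neg, Quaternion.imK_neg,
      Quaternion.re_one, Quaternion.imI_one, Quaternion.imJ_one, Quaternion.imK_one] at h1 h2 h3 h4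
    have h0 : a.re = 0 := by
      by_contra hne
      have e2 : a.imI = 0 := by
        have : a.re * a.imI = 0 := by linarith
        simpa [hne] using this
      have e3 : a.imJ = 0 := by
        have : a.re * a.imJ = 0 := by linarith
        simpa [hne] using this
      have e4 : a.imK = 0 := by
        have : a.re * a.imK = 0 := by linarith
        simpa [hne] using this
      rw [e2, e3, e4] at h1
      nlinarith [mul_self_nonneg a.re]
    refine ⟨h0, ?_⟩
    rw [h0] at h1
    linarith
  · rintro ⟨h0, h1⟩
    ext <;> simp [h0]
    · linarith
    · ring
    · ring
    · ring

lemma norm_eq_one_of_sq_eq_neg_one {a : Quaternion ℝ} (h : a * a = -1) : ‖a‖ = 1 := by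
  have := congrArg norm h
  rw [norm_mul, norm_neg, norm_one] at this
  nlinarith [norm_nonneg a]

/-- The rotor `1 - t b a` interpolating between `1` and a quaternion conjugating `a` to `b`. -/
def rotor (a b : Quaternion ℝ) (t : ℝ) : Quaternion ℝ := 1 - (t : Quaternion ℝ) * (b * a)

@[simp] lemma rotor_zero (a b : Quaternion ℝ) : rotor a b 0 = 1 := by simp [rotor]

lemma continuous_rotor (a b : Quaternion ℝ) : Continuous (rotor a b) := by
  unfold rotor
  have := Quaternion.continuous_coe
  fun_prop

lemma re_mul_lt_one {a b : Quaternion ℝ} (ha : a * a = -1) (hb : b * b = -1) (hne : b ≠ -a) :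
    (b * a).re < 1 := by
  obtain ⟨ha0, ha1⟩ := sq_eq_neg_one_iff.mp ha
  obtain ⟨hb0, hb1⟩ := sq_eq_neg_one_iff.mp hb
  by_contra! hle
  apply hne
  simp only [Quaternion.re_mul, ha0, hb0] at hle
  have h : (b.imI + a.imI) ^ 2 + (b.imJ + a.imJ) ^ 2 + (b.imK + a.imK) ^ 2 = 0 := by
    apply le_antisymm _ (by positivity)
    nlinarith
  have e1 : b.imI + a.imI = 0 := by
    nlinarith [sq_nonneg (b.imI + a.imI), sq_nonneg (b.imJ + a.imJ), sq_nonneg (b.imK + a.imK)]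
  have e2 : b.imJ + a.imJ = 0 := by
    nlinarith [sq_nonneg (b.imI + a.imI), sq_nonneg (b.imJ + a.imJ), sq_nonneg (b.imK + a.imK)]
  have e3 : b.imK + a.imK = 0 := by
    nlinarith [sq_nonneg (b.imI + a.imI), sq_nonneg (b.imJ + a.imJ), sq_nonneg (b.imK + a.imK)]
  ext <;> simp [ha0, hb0] <;> linarith

lemma re_rotor_pos {a b : Quaternion ℝ} (ha : a * a = -1) (hb : b * b = -1) (hne : b ≠ -a)
    {t : ℝ} (ht : t ∈ unitInterval) : 0 < (rotor a b t).re := by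
  have h := re_mul_lt_one ha hb hne
  have e : (rotor a b t).re = 1 - t * (b * a).re := by
    rw [rotor, Quaternion.re_sub, Quaternion.coe_mul_eq_smul, Quaternion.re_smul]; simp
  rw [e]
  rcases le_total (b * a).re 0 with hm | hm
  · nlinarith [ht.1]
  · nlinarith [ht.2]

lemma rotor_ne_zero {a b : Quaternion ℝ} (ha : a * a = -1) (hb : b * b = -1) (hne : b ≠ -a)
    {t : ℝ} (ht : t ∈ unitInterval) : rotor a b t ≠ 0 := by
  intro h
  have := re_rotor_pos ha hb hne ht
  simp [h] at this

lemma rotor_one_conj {a b : Quaternion ℝ} (ha : a * a = -1) (hb : b * b = -1) (hne : b ≠ -a) :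
    rotor a b 1 * a * (rotor a b 1)⁻¹ = b := by
  have h0 := rotor_ne_zero ha hb hne unitInterval.one_mem
  have : rotor a b 1 * a = b * rotor a b 1 := by
    simp only [rotor, Quaternion.coe_one, one_mul, sub_mul, mul_sub, mul_one, mul_assoc, ha]
    rw [← mul_assoc b b, hb]
    simp [add_comm]
  rw [this, mul_assoc, mul_inv_cancel₀ h0, mul_one]

lemma rotor_commute {a b c : Quaternion ℝ} (ha : c * a = -(a * c)) (hb : c * b = -(b * c))
    (t : ℝ) : rotor a b t * c = c * rotor a b t := by
  simp only [rotor, sub_mul, mul_sub, one_mul, mul_one]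
  congr 1
  rw [← mul_assoc c, ← Quaternion.coe_commutes t c, mul_assoc, mul_assoc, mul_assoc,
    ← mul_assoc c, hb, neg_mul, mul_assoc b c, ha]
  simp

lemma conj_anticommute {r a c : Quaternion ℝ} (hr : r ≠ 0) (hrc : r * c = c * r)
    (h : c * a = -(a * c)) : c * (r * a * r⁻¹) = -(r * a * r⁻¹ * c) := by
  have hi : r⁻¹ * c = c * r⁻¹ := by
    rw [inv_mul_eq_iff_eq_mul₀ hr, ← mul_assoc, hrc, mul_assoc, mul_inv_cancel₀ hr, mul_one]
  calc c * (r * a * r⁻¹) = c * r * a * r⁻¹ := by simp only [mul_assoc]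
    _ = r * (c * a) * r⁻¹ := by rw [← hrc]; simp only [mul_assoc]
    _ = -(r * a * (c * r⁻¹)) := by rw [h]; simp [mul_assoc]
    _ = _ := by rw [← hi]; simp only [mul_assoc]

/-- The quaternions `1, i, j, k`. -/
def basisQuat : Fin 4 → Quaternion ℝ :=
  ![⟨1, 0, 0, 0⟩, ⟨0, 1, 0, 0⟩, ⟨0, 0, 1, 0⟩, ⟨0, 0, 0, 1⟩]

/-- The quaternion group `{±1, ±i, ±j, ±k}`, as a set of quaternions. -/
def quatGroup : Set (Quaternion ℝ) := {q | ∃ n, q = basisQuat n ∨ q = -basisQuat n}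

lemma neg_mem_quatGroup {q : Quaternion ℝ} (h : q ∈ quatGroup) : -q ∈ quatGroup := by
  obtain ⟨n, rfl | rfl⟩ := h
  exacts [⟨n, Or.inr rfl⟩, ⟨n, Or.inl (neg_neg _)⟩]

lemma mem_quatGroup_of_eq_or_neg {q p : Quaternion ℝ} (h : q ∈ quatGroup) (hp : p = q ∨ p = -q) :
    p ∈ quatGroup := by
  rcases hp with rfl | rfl
  exacts [h, neg_mem_quatGroup h]

lemma mem_quatGroup_of_sq_eq_one {q : Quaternion ℝ} (h : q * q = 1) : q ∈ quatGroup := by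
  have h1 : basisQuat 0 = 1 := by ext <;> simp [basisQuat]
  rcases mul_self_eq_one_iff.mp h with rfl | rfl
  exacts [⟨0, Or.inl h1.symm⟩, ⟨0, Or.inr (by rw [h1])⟩]

lemma basisQuat_sq {n : Fin 4} (hn : n ≠ 0) : basisQuat n * basisQuat n = -1 := by
  fin_cases n
  · exact absurd rfl hn
  all_goals rw [sq_eq_neg_one_iff]; simp [basisQuat]

lemma basisQuat_anticommute {m n : Fin 4} (hm : m ≠ 0) (hn : n ≠ 0) (hmn : m ≠ n) :
    basisQuat m * basisQuat n = -(basisQuat n * basisQuat m) := by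
  ext <;> simp only [Quaternion.re_neg, Quaternion.imI_neg, Quaternion.imJ_neg, Quaternion.imK_neg,
    Quaternion.re_mul, Quaternion.imI_mul, Quaternion.imJ_mul, Quaternion.imK_mul] <;>
  fin_cases m <;> fin_cases n <;> simp [basisQuat] at hm hn hmn ⊢

lemma basisQuat_commute {m n : Fin 4} (h : m = 0 ∨ n = 0 ∨ m = n) :
    basisQuat m * basisQuat n = basisQuat n * basisQuat m := by
  have h1 : basisQuat 0 = 1 := by ext <;> simp [basisQuat]
  rcases h with rfl | rfl | rfl
  · simp [h1]
  · simp [h1]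
  · rfl

lemma exists_quatGroup_anticommute {c : Quaternion ℝ} (hc : c ∈ quatGroup) (hc2 : c * c = -1) :
    ∃ b ∈ quatGroup, b * b = -1 ∧ c * b = -(b * c) := by
  obtain ⟨n, hn⟩ := hc
  have hn0 : n ≠ 0 := by
    rintro rfl
    have h1 : basisQuat 0 = 1 := by ext <;> simp [basisQuat]
    rw [h1] at hn
    have : c * c = 1 := by rcases hn with rfl | rfl <;> simp
    rw [this] at hc2
    have := congrArg (·.re) hc2
    norm_num at this
  obtain ⟨m, hm0, hmn⟩ : ∃ m : Fin 4, m ≠ 0 ∧ n ≠ m := by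
    clear hn hn0; revert n; decide
  refine ⟨basisQuat m, ⟨m, Or.inl rfl⟩, basisQuat_sq hm0, ?_⟩
  have := basisQuat_anticommute hn0 hm0 hmn
  rcases hn with rfl | rfl
  · exact this
  · rw [neg_mul, this, mul_neg]


lemma normalize_sq {x : ℍ[ℝ]} (hx : star x = -x) (h0 : x ≠ 0) :
    (‖x‖⁻¹ • x) * (‖x‖⁻¹ • x) = -1 := by
  have h1 : x * x = -((‖x‖ * ‖x‖ : ℝ) : ℍ[ℝ]) := by
    rw [← Quaternion.normSq_eq_norm_mul_self, ← Quaternion.self_mul_star, hx, mul_neg, neg_neg]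
  have h2 : ‖x‖ ≠ 0 := norm_ne_zero_iff.mpr h0
  rw [smul_mul_smul_comm, h1, smul_neg, Quaternion.smul_coe]
  congr 1
  rw [← Quaternion.coe_one]
  congr 1
  field_simp

lemma star_eq_neg_of_sq {a : ℍ[ℝ]} (ha : a * a = -1) : star a = -a :=
  Quaternion.star_eq_neg.mpr (sq_eq_neg_one_iff.mp ha).1

lemma star_commutator {a d : ℍ[ℝ]} (ha : a * a = -1) (hd : d * d = -1) :
    star (a * d - d * a) = -(a * d - d * a) := by
  simp [star_eq_neg_of_sq ha, star_eq_neg_of_sq hd]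

lemma commute_commutator {a d b : ℍ[ℝ]} (hba : b * a = -(a * b)) (hbd : b * d = -(d * b)) :
    b * (a * d - d * a) = (a * d - d * a) * b := by
  rw [mul_sub, sub_mul, ← mul_assoc, ← mul_assoc, hba, hbd, neg_mul, neg_mul, mul_assoc, hbd,
    mul_assoc, hba]
  simp [mul_assoc]

/-- Two square roots of `-1` anticommuting with two others that do not commute agree up to
sign. -/
lemma eq_or_eq_neg_of_anticommute {a d b c : ℍ[ℝ]} (ha : a * a = -1) (hd : d * d = -1)
    (hb : b * b = -1) (hc : c * c = -1)
    (hba : b * a = -(a * b)) (hbd : b * d = -(d * b)) (hca : c * a = -(a * c))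
    (hcd : c * d = -(d * c)) (had : a * d ≠ d * a) : b = c ∨ b = -c := by
  have hx0 : a * d - d * a ≠ 0 := sub_ne_zero.mpr had
  have hy := normalize_sq (star_commutator ha hd) hx0
  have e1 := eq_or_eq_neg_of_commute hb hy
    (by rw [mul_smul_comm, smul_mul_assoc, commute_commutator hba hbd])
  have e2 := eq_or_eq_neg_of_commute hc hy
    (by rw [mul_smul_comm, smul_mul_assoc, commute_commutator hca hcd])
  rcases e1 with e1 | e1 <;> rcases e2 with e2 | e2 <;> simp [e1, e2]

section Alignment

variable {V : Type*}

/-- Vertexwise conjugation of a tuple of quaternions. -/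
def conjFun (R q : V → ℍ[ℝ]) : V → ℍ[ℝ] := fun v => R v * q v * (R v)⁻¹

lemma conjFun_conjFun (R' R q : V → ℍ[ℝ]) : conjFun R' (conjFun R q) = conjFun (R' * R) q := by
  funext v
  simp [conjFun, mul_assoc]

@[simp] lemma conjFun_one (q : V → ℍ[ℝ]) : conjFun 1 q = q := by
  funext v
  simp [conjFun]

/-- The tuple `q` commutes up to sign along the edges of `G` inside `S`. -/
def SignCommutesOn (G : SimpleGraph V) (S : Finset V) (q : V → ℍ[ℝ]) : Prop :=
  ∀ a ∈ S, ∀ b ∈ S, G.Adj a b → SignCommute (q a) (q b)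

/-- Each entry of `q` over `S` is `±1` or a square root of `-1`. -/
def RealOrPureOn (S : Finset V) (q : V → ℍ[ℝ]) : Prop :=
  ∀ v ∈ S, q v * q v = 1 ∨ q v * q v = -1

lemma RealOrPureOn.conjFun {S : Finset V} {q R : V → ℍ[ℝ]} (h : RealOrPureOn S q)
    (hR : ∀ v, R v ≠ 0) : RealOrPureOn S (conjFun R q) := by
  intro v hv
  rcases h v hv with h | h
  · left
    simp only [_root_.conjFun]
    rw [conj_of_sq_eq_one (hR v) h, h]
  · right
    exact conj_sq_eq_neg_one (hR v) h

/-- The tuples of nonzero quaternions conjugation by which keeps `q` sign-commuting. -/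
def conjugators (G : SimpleGraph V) (S : Finset V) (q : V → ℍ[ℝ]) : Set (V → ℍ[ℝ]) :=
  {R | (∀ v, R v ≠ 0) ∧ SignCommutesOn G S (conjFun R q)}

/-- The tuple `q` can be moved by a path of vertexwise conjugations into the quaternion group. -/
def Alignable (G : SimpleGraph V) (S : Finset V) (q : V → ℍ[ℝ]) : Prop :=
  ∃ R, JoinedIn (conjugators G S q) 1 R ∧ ∀ v ∈ S, conjFun R q v ∈ quatGroup

variable {G G' : SimpleGraph V} {S S' : Finset V} {q : V → ℍ[ℝ]}

lemma Alignable.of_joinedIn {R : V → ℍ[ℝ]} (hR : JoinedIn (conjugators G S q) 1 R)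
    (h : Alignable G S (conjFun R q)) : Alignable G S q := by
  obtain ⟨R', hR', hq⟩ := h
  refine ⟨R' * R, hR.trans ?_, fun v hv => by rw [← conjFun_conjFun]; exact hq v hv⟩
  have := (hR'.map (f := fun x : V → ℍ[ℝ] => x * R) (by fun_prop))
  rw [one_mul] at this
  refine this.mono ?_
  rintro _ ⟨x, ⟨hx0, hx⟩, rfl⟩
  refine ⟨fun v => mul_ne_zero (hx0 v) (hR.target_mem.1 v), ?_⟩
  rwa [← conjFun_conjFun]

lemma alignable_of_mem (h : SignCommutesOn G S q) (hq : ∀ v ∈ S, q v ∈ quatGroup) :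
    Alignable G S q :=
  ⟨1, JoinedIn.refl ⟨fun _ => one_ne_zero, by simpa using h⟩, by simpa using hq⟩

lemma joinedIn_conjugators {f : ℝ → V → ℍ[ℝ]}
    (hf : ∀ v, ContinuousOn (fun t => f t v) unitInterval) (h0 : f 0 = 1)
    (hne : ∀ t ∈ unitInterval, ∀ v, f t v ≠ 0)
    (hadm : ∀ t ∈ unitInterval, SignCommutesOn G S (conjFun (f t) q)) :
    JoinedIn (conjugators G S q) 1 (f 1) := by
  refine JoinedIn.ofLine (continuousOn_pi.mpr hf) h0 rfl ?_
  rintro _ ⟨t, ht, rfl⟩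
  exact ⟨hne t ht, hadm t ht⟩

lemma Alignable.of_pullback (σ : V → V) (h : Alignable G' S' q)
    (hσ : ∀ R ∈ conjugators G' S' q, SignCommutesOn G S (conjFun (R ∘ σ) q))
    (hfin : ∀ R ∈ conjugators G' S' q, (∀ v ∈ S', conjFun R q v ∈ quatGroup) →
      Alignable G S (conjFun (R ∘ σ) q)) : Alignable G S q := by
  obtain ⟨R, hR, hq⟩ := h
  have := (hR.map (f := fun x : V → ℍ[ℝ] => x ∘ σ) (by fun_prop))
  refine Alignable.of_joinedIn (this.mono ?_) (hfin R hR.target_mem hq)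
  rintro _ ⟨x, hx, rfl⟩
  exact ⟨fun v => hx.1 (σ v), hσ x hx⟩

lemma SignCommutesOn.mono (h : SignCommutesOn G S q) (hS : S' ⊆ S) : SignCommutesOn G S' q :=
  fun a ha b hb hab => h a (hS ha) b (hS hb) hab

variable [DecidableEq V]

lemma SignCommutesOn.of_erase {v : V} (h : SignCommutesOn G (S.erase v) q)
    (hv : ∀ u ∈ S, G.Adj v u → SignCommute (q v) (q u)) : SignCommutesOn G S q := by
  intro a ha b hb hab
  by_cases hav : a = v
  · subst hav
    exact hv b hb hab
  by_cases hbv : b = v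
  · subst hbv
    exact (hv a ha hab.symm).symm
  exact h a (by simp [*]) b (by simp [*]) hab

/-- Rotating the pure entry at `v` to `b`, when the adjacent entries allow it. -/
lemma Alignable.of_update {v : V} {b : ℍ[ℝ]} (hq : SignCommutesOn G S q) (ha : q v * q v = -1)
    (hb : b * b = -1) (hne : b ≠ -q v)
    (hnb : ∀ u ∈ S, G.Adj v u → q u * q u = 1 ∨
      q u * q v = -(q v * q u) ∧ q u * b = -(b * q u))
    (h : SignCommutesOn G S (Function.update q v b) → Alignable G S (Function.update q v b)) :
    Alignable G S q := by
  have hJ : JoinedIn (conjugators G S q) 1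
      (Function.update (1 : V → ℍ[ℝ]) v (rotor (q v) b 1)) := by
    refine joinedIn_conjugators
      (f := fun t => Function.update (1 : V → ℍ[ℝ]) v (rotor (q v) b t)) ?_ ?_ ?_ ?_
    · intro u
      by_cases hu : u = v
      · subst hu
        simpa using (continuous_rotor (q u) b).continuousOn
      · simpa [Function.update_of_ne hu] using continuousOn_const
    · simp
    · intro t ht u
      by_cases hu : u = v
      · subst hu
        simpa using rotor_ne_zero ha hb hne ht
      · simp [Function.update_of_ne hu]
    · intro t ht
      apply SignCommutesOn.of_erase (v := v)
      · intro x hx y hy hxy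
        simpa [conjFun, Finset.ne_of_mem_erase hx, Finset.ne_of_mem_erase hy] using
          hq x (Finset.mem_of_mem_erase hx) y (Finset.mem_of_mem_erase hy) hxy
      · intro u hu hvu
        have huv : u ≠ v := hvu.ne'
        simp only [conjFun, Function.update_self, Function.update_of_ne huv, Pi.one_apply, one_mul,
          inv_one, mul_one]
        rcases hnb u hu hvu with h1 | ⟨h1, h2⟩
        · exact SignCommute.of_sq_eq_one_right _ h1
        · refine SignCommute.symm (Or.inr ?_)
          exact conj_anticommute (rotor_ne_zero ha hb hne ht) (rotor_commute h1 h2 t) h1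
  have e : conjFun (Function.update (1 : V → ℍ[ℝ]) v (rotor (q v) b 1)) q =
      Function.update q v b := by
    funext u
    by_cases hu : u = v
    · subst hu
      simp [conjFun, rotor_one_conj ha hb hne]
    · simp [conjFun, Function.update_of_ne hu]
  refine Alignable.of_joinedIn hJ ?_
  rw [e]
  apply h
  rw [← e]
  exact hJ.target_mem.2

lemma alignable_of_update_mem {v : V} {b : ℍ[ℝ]} (hq : SignCommutesOn G S q)
    (ha : q v * q v = -1) (hb : b * b = -1) (hbm : b ∈ quatGroup)
    (hnb : ∀ u ∈ S, G.Adj v u → q u * q u = 1 ∨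
      q u * q v = -(q v * q u) ∧ q u * b = -(b * q u))
    (hm : ∀ u ∈ S, u ≠ v → q u ∈ quatGroup) : Alignable G S q := by
  by_cases hne : b = -q v
  · refine alignable_of_mem hq fun u hu => ?_
    by_cases huv : u = v
    · subst huv
      exact mem_quatGroup_of_eq_or_neg hbm (Or.inr (by rw [hne, neg_neg]))
    · exact hm u hu huv
  · refine Alignable.of_update hq ha hb hne hnb fun h => alignable_of_mem h fun u hu => ?_
    by_cases huv : u = v
    · subst huv
      simpa using hbm
    · simpa [huv] using hm u hu huv

/-- If every entry but the pure one at `v` is in the quaternion group and every neighbour of `v`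
carries a real entry, then the tuple is alignable. -/
lemma alignable_of_neighbors_real {v : V} (hq : SignCommutesOn G S q) (ha : q v * q v = -1)
    (hnb : ∀ u ∈ S, G.Adj v u → q u * q u = 1) (hm : ∀ u ∈ S, u ≠ v → q u ∈ quatGroup) :
    Alignable G S q :=
  alignable_of_update_mem hq ha (basisQuat_sq (n := 1) (by decide)) ⟨1, Or.inl rfl⟩
    (fun u hu huv => Or.inl (hnb u hu huv)) hm

/-- If every entry but the pure one at `v` is in the quaternion group and the neighbours of `v`
carry `±c` with `c` anticommuting with the entry at `v`, then the tuple is alignable. -/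
lemma alignable_of_neighbors_eq {v : V} {c : ℍ[ℝ]} (hq : SignCommutesOn G S q)
    (ha : q v * q v = -1) (hc : c * c = -1) (hcm : c ∈ quatGroup) (hcv : c * q v = -(q v * c))
    (hnb : ∀ u ∈ S, G.Adj v u → q u = c ∨ q u = -c) (hm : ∀ u ∈ S, u ≠ v → q u ∈ quatGroup) :
    Alignable G S q := by
  obtain ⟨b, hbm, hb, hcb⟩ := exists_quatGroup_anticommute hcm hc
  refine alignable_of_update_mem hq ha hb hbm (fun u hu huv => Or.inr ?_) hm
  rcases hnb u hu huv with h | h <;> rw [h]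
  · exact ⟨hcv, hcb⟩
  · simp [hcv, hcb]

/-- Adding a vertex with at most one neighbour preserves alignability. -/
lemma Alignable.of_erase {v : V} (hv : v ∈ S)
    (hleaf : ∀ a ∈ S, ∀ b ∈ S, G.Adj v a → G.Adj v b → a = b)
    (hq : SignCommutesOn G S q) (hp : RealOrPureOn S q) (h : Alignable G (S.erase v) q) :
    Alignable G S q := by
  by_cases hreal : q v * q v = 1 ∨ ∀ u ∈ S, G.Adj v u → q u * q u = 1
  · have hσ : ∀ R ∈ conjugators G (S.erase v) q, SignCommutesOn G S (conjFun (R ∘ id) q) := by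
      intro R hR
      refine hR.2.of_erase fun u hu huv => ?_
      rcases hreal with h1 | h1
      · apply SignCommute.of_sq_eq_one_left
        simp only [conjFun, conj_of_sq_eq_one (hR.1 v) h1, h1]
      · apply SignCommute.of_sq_eq_one_right
        simp only [conjFun, conj_of_sq_eq_one (hR.1 u) (h1 u hu huv), h1 u hu huv]
    refine h.of_pullback id hσ fun R hR hm => ?_
    have hm' : ∀ u ∈ S, u ≠ v → conjFun (R ∘ id) q u ∈ quatGroup := fun u hu huv =>
      hm u (Finset.mem_erase.mpr ⟨huv, hu⟩)
    rcases hp v hv with h1 | h1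
    · refine alignable_of_mem (hσ R hR) fun u hu => ?_
      by_cases huv : u = v
      · subst huv
        simp only [Function.comp_id, conjFun, conj_of_sq_eq_one (hR.1 u) h1]
        exact mem_quatGroup_of_sq_eq_one h1
      · exact hm' u hu huv
    · refine alignable_of_neighbors_real (v := v) (hσ R hR) (conj_sq_eq_neg_one (hR.1 v) h1) ?_ hm'
      intro u hu huv
      rcases hreal with h2 | h2
      · rw [h1] at h2
        have := congrArg (·.re) h2
        norm_num at this
      · simp only [Function.comp_id, conjFun, conj_of_sq_eq_one (hR.1 u) (h2 u hu huv), h2 u hu huv]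
  · push Not at hreal
    obtain ⟨hv1, w, hw, hvw, hw1⟩ := hreal
    have hv2 := (hp v hv).resolve_left hv1
    have hw2 := (hp w hw).resolve_left hw1
    have hwv : w ≠ v := hvw.ne'
    have hwS : w ∈ S.erase v := Finset.mem_erase.mpr ⟨hwv, hw⟩
    set σ : V → V := fun u => if u = v then w else u with hσdef
    have hσv : σ v = w := by simp [hσdef]
    have hσu : ∀ u, u ≠ v → σ u = u := fun u hu => by simp [hσdef, hu]
    have hu : ∀ (R : V → ℍ[ℝ]) u, u ≠ v → conjFun (R ∘ σ) q u = conjFun R q u := fun R u hu => by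
      simp [conjFun, hσu u hu]
    have hσ : ∀ R ∈ conjugators G (S.erase v) q, SignCommutesOn G S (conjFun (R ∘ σ) q) := by
      intro R hR
      refine SignCommutesOn.of_erase (v := v) ?_ fun u huS huv => ?_
      · intro a ha b hb hab
        rw [hu R a (Finset.ne_of_mem_erase ha), hu R b (Finset.ne_of_mem_erase hb)]
        exact hR.2 a ha b hb hab
      · obtain rfl := hleaf u huS w hw huv hvw
        rw [hu R u hwv]
        simp only [conjFun, Function.comp_apply, hσv]
        exact (hq v hv u hw hvw).conj (hR.1 u)
    refine h.of_pullback σ hσ fun R hR hm => ?_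
    have hm' : ∀ u ∈ S, u ≠ v → conjFun (R ∘ σ) q u ∈ quatGroup := fun u huS huv => by
      rw [hu R u huv]
      exact hm u (Finset.mem_erase.mpr ⟨huv, huS⟩)
    have hcw : conjFun (R ∘ σ) q w = R w * q w * (R w)⁻¹ := by rw [hu R w hwv]; rfl
    have hcv : conjFun (R ∘ σ) q v = R w * q v * (R w)⁻¹ := by simp [conjFun, hσv]
    rcases hq v hv w hw hvw with hc | hc
    · refine alignable_of_mem (hσ R hR) fun u huS => ?_
      by_cases huv : u = v
      · subst huv
        refine mem_quatGroup_of_eq_or_neg (hm' w hw hwv) ?_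
        rw [hcv, hcw]
        rcases eq_or_eq_neg_of_commute hv2 hw2 hc with h | h <;> simp [h]
      · exact hm' u huS huv
    · refine alignable_of_neighbors_eq (v := v) (c := conjFun (R ∘ σ) q w) (hσ R hR) ?_ ?_
        (hm' w hw hwv) ?_ ?_ hm'
      · rw [hcv]; exact conj_sq_eq_neg_one (hR.1 w) hv2
      · rw [hcw]; exact conj_sq_eq_neg_one (hR.1 w) hw2
      · rw [hcv, hcw]
        have key (a b : ℍ[ℝ]) : R w * a * (R w)⁻¹ * (R w * b * (R w)⁻¹) =
            R w * (a * b) * (R w)⁻¹ := by simp [mul_assoc, hR.1 w]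
        rw [key, key, hc]; simp
      · intro u huS huv
        obtain rfl := hleaf u huS w hw huv hvw
        exact Or.inl rfl

end Alignment

lemma anticommute_commutator_left {a d : ℍ[ℝ]} (ha : a * a = -1) :
    (a * d - d * a) * a = -(a * (a * d - d * a)) := by
  rw [sub_mul, mul_sub, mul_assoc d, ha, ← mul_assoc a a, ha]
  simp [mul_assoc, add_comm]

lemma anticommute_commutator_right {a d : ℍ[ℝ]} (hd : d * d = -1) :
    (a * d - d * a) * d = -(d * (a * d - d * a)) := by
  have := anticommute_commutator_left (d := a) hd
  have e : a * d - d * a = -(d * a - a * d) := (neg_sub _ _).symm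
  rw [e, neg_mul, this, mul_neg]

lemma not_commute_of_anticommute {a b c d z : ℍ[ℝ]} (ha : a * a = -1) (hb : b * b = -1)
    (hc : c * c = -1) (hd : d * d = -1) (hba : b * a = -(a * b)) (hbd : b * d = -(d * b))
    (hca : c * a = -(a * c)) (had : a * d ≠ d * a) (hbc : b ≠ c) (hbc' : b ≠ -c)
    (hz : star z = -z) (hz0 : z ≠ 0) (hcz : c * z = -(z * c)) : z * d ≠ d * z := by
  intro h
  have hy := normalize_sq hz hz0
  have hcy : c * (‖z‖⁻¹ • z) = -(‖z‖⁻¹ • z * c) := by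
    rw [mul_smul_comm, smul_mul_assoc, hcz, smul_neg]
  have hcd : c * d = -(d * c) := by
    rcases eq_or_eq_neg_of_commute hd hy (by rw [mul_smul_comm, smul_mul_assoc, h]) with e | e
    · rw [e, hcy]
    · rw [e, mul_neg, hcy, neg_mul]
  rcases eq_or_eq_neg_of_anticommute ha hd hb hc hba hbd hca hcd had with e | e
  exacts [hbc e, hbc' e]

lemma conj_ne_neg {a r : ℍ[ℝ]} (ha : a * a = -1) (hr : 0 < r.re) : r * a * r⁻¹ ≠ -a := by
  intro h
  have hr0 : r ≠ 0 := by rintro rfl; simp at hr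
  have h1 : r * a = -(a * r) := by
    rw [mul_inv_eq_iff_eq_mul₀ hr0] at h
    rw [h, neg_mul]
  have h2 : r = a * r * a := by
    have := congrArg (· * a) h1
    simp only [mul_assoc, ha] at this
    rw [mul_neg, mul_one, neg_mul, neg_inj] at this
    exact this
  have h3 : (a * r * a).re = (a * a * r).re := by
    simp only [Quaternion.re_mul, Quaternion.imI_mul, Quaternion.imJ_mul, Quaternion.imK_mul]
    ring
  rw [← h2, ha, neg_one_mul, Quaternion.re_neg] at h3
  linarith

/-- While the pure quaternion `a` rotates to `e` about `c`, a pure quaternion `b ⊥ a, d` can follow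
it staying perpendicular to the fixed `d`. -/
lemma exists_following_rotor {a b c d e : ℍ[ℝ]} (ha : a * a = -1) (hb : b * b = -1)
    (hc : c * c = -1) (hd : d * d = -1) (he : e * e = -1)
    (hba : b * a = -(a * b)) (hbd : b * d = -(d * b))
    (hca : c * a = -(a * c)) (hce : c * e = -(e * c)) (had : a * d ≠ d * a)
    (hbc : b ≠ c) (hbc' : b ≠ -c) (hea : e ≠ -a) :
    ∃ r : ℝ → ℍ[ℝ], ContinuousOn r unitInterval ∧ r 0 = 1 ∧ ∀ t ∈ unitInterval, r t ≠ 0 ∧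
      SignCommute (r t * b * (r t)⁻¹) d ∧
      SignCommute (r t * b * (r t)⁻¹) (rotor a e t * a * (rotor a e t)⁻¹) := by
  set A : ℝ → ℍ[ℝ] := fun t => rotor a e t * a * (rotor a e t)⁻¹ with hA
  have hr0 : ∀ t ∈ unitInterval, rotor a e t ≠ 0 := fun t ht => rotor_ne_zero ha he hea ht
  have hAc : ContinuousOn A unitInterval :=
    ((continuous_rotor a e).continuousOn.mul continuousOn_const).mul
      ((continuous_rotor a e).continuousOn.inv₀ hr0)
  have hA0 : A 0 = a := by simp [hA]
  have hA2 : ∀ t ∈ unitInterval, A t * A t = -1 := fun t ht => conj_sq_eq_neg_one (hr0 t ht) ha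
  have hcA : ∀ t ∈ unitInterval, c * A t = -(A t * c) := fun t ht =>
    conj_anticommute (hr0 t ht) (rotor_commute hca hce t) hca
  have hno : ∀ z : ℍ[ℝ], star z = -z → z ≠ 0 → c * z = -(z * c) → z * d ≠ d * z :=
    fun z hz hz0 hcz => not_commute_of_anticommute ha hb hc hd hba hbd hca had hbc hbc' hz hz0 hcz
  set x : ℝ → ℍ[ℝ] := fun t => A t * d - d * A t with hx
  have hx0 : ∀ t ∈ unitInterval, x t ≠ 0 := fun t ht => sub_ne_zero.mpr <|
    hno _ (star_eq_neg_of_sq (hA2 t ht)) (by intro h; simpa [h] using hA2 t ht) (hcA t ht)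
  have hxc : ContinuousOn x unitInterval :=
    (hAc.mul continuousOn_const).sub (continuousOn_const.mul hAc)
  set y : ℝ → ℍ[ℝ] := fun t => ‖x t‖⁻¹ • x t with hy
  have hyc : ContinuousOn y unitInterval :=
    (hxc.norm.inv₀ fun t ht => norm_ne_zero_iff.mpr (hx0 t ht)).smul hxc
  have hy2 : ∀ t ∈ unitInterval, y t * y t = -1 := fun t ht =>
    normalize_sq (star_commutator (hA2 t ht) hd) (hx0 t ht)
  have h0 : (0 : ℝ) ∈ unitInterval := unitInterval.zero_mem
  obtain ⟨κ, hκ, hbκ⟩ : ∃ κ : ℍ[ℝ], (κ = 1 ∨ κ = -1) ∧ b = κ * y 0 := by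
    rcases eq_or_eq_neg_of_commute hb (hy2 0 h0) (by
      simp only [hy, hx, hA0]
      rw [mul_smul_comm, smul_mul_assoc, commute_commutator hba hbd]) with h | h
    · exact ⟨1, Or.inl rfl, by simpa using h⟩
    · exact ⟨-1, Or.inr rfl, by simpa using h⟩
  set Y : ℝ → ℍ[ℝ] := fun t => κ * y t with hY
  have hYc : ContinuousOn Y unitInterval := continuousOn_const.mul hyc
  have hY2 : ∀ t ∈ unitInterval, Y t * Y t = -1 := fun t ht => by
    rcases hκ with rfl | rfl <;> simp [hY, hy2 t ht]
  have hYd : ∀ t ∈ unitInterval, Y t * d = -(d * Y t) := fun t ht => by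
    have : x t * d = -(d * x t) := anticommute_commutator_right hd
    rcases hκ with rfl | rfl <;> simp [hY, hy, this]
  have hYA : ∀ t ∈ unitInterval, Y t * A t = -(A t * Y t) := fun t ht => by
    have : x t * A t = -(A t * x t) := anticommute_commutator_left (hA2 t ht)
    rcases hκ with rfl | rfl <;> simp [hY, hy, this]
  have hYne : ∀ t ∈ unitInterval, Y t ≠ -b := by
    intro t ht h
    have hyy : y t = -y 0 := by
      rw [hbκ] at h
      rcases hκ with rfl | rfl
      · simpa [hY] using h
      · exact neg_eq_iff_eq_neg.mp (by simpa [hY] using h)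
    have s0 : 0 < ‖x t‖⁻¹ := inv_pos.mpr (norm_pos_iff.mpr (hx0 t ht))
    have s1 : 0 < ‖x 0‖⁻¹ := inv_pos.mpr (norm_pos_iff.mpr (hx0 0 h0))
    refine hno (‖x t‖⁻¹ • A t + ‖x 0‖⁻¹ • a) ?_ ?_ ?_ ?_
    · simp only [star_add, Quaternion.star_smul, star_eq_neg_of_sq (hA2 t ht), star_eq_neg_of_sq ha,
        smul_neg]
      abel
    · intro hz
      have e1 : ‖x t‖⁻¹ • A t = -(‖x 0‖⁻¹ • a) := eq_neg_of_add_eq_zero_left hz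
      have e2 : ‖x t‖⁻¹ = ‖x 0‖⁻¹ := by
        have := congrArg norm e1
        rwa [norm_neg, norm_smul, norm_smul, norm_eq_one_of_sq_eq_neg_one (hA2 t ht),
          norm_eq_one_of_sq_eq_neg_one ha, Real.norm_of_nonneg s0.le, Real.norm_of_nonneg s1.le,
          mul_one, mul_one] at this
      rw [e2, ← smul_neg] at e1
      exact conj_ne_neg ha (re_rotor_pos ha he hea ht) (smul_right_injective _ s1.ne' e1)
    · simp only [mul_add, add_mul, mul_smul_comm, smul_mul_assoc, hcA t ht, hca, smul_neg]
      abel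
    · have e1 : ‖x t‖⁻¹ • (A t * d - d * A t) = -(‖x 0‖⁻¹ • (a * d - d * a)) := by
        simpa only [hy, hx, hA0] using hyy
      simp only [mul_add, add_mul, mul_smul_comm, smul_mul_assoc]
      rw [smul_sub, smul_sub] at e1
      rw [← sub_eq_zero]
      rw [← sub_eq_zero] at e1
      rw [← e1]
      abel
  have hs : (2⁻¹ : ℝ) ≠ 0 := by norm_num
  have hconj : ∀ t ∈ unitInterval,
      (2⁻¹ : ℝ) • rotor b (Y t) 1 * b * ((2⁻¹ : ℝ) • rotor b (Y t) 1)⁻¹ = Y t := fun t ht => by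
    rw [smul_inv₀, smul_mul_assoc, smul_mul_smul_comm, mul_inv_cancel₀ hs, one_smul,
      rotor_one_conj hb (hY2 t ht) (hYne t ht)]
  refine ⟨fun t => (2⁻¹ : ℝ) • rotor b (Y t) 1, ?_, ?_, fun t ht => ⟨?_, ?_, ?_⟩⟩
  · simp only [rotor]
    fun_prop
  · have : Y 0 = b := hbκ.symm
    simp only [this, rotor, hb]
    ext <;> simp <;> norm_num
  · exact smul_ne_zero hs (rotor_ne_zero hb (hY2 t ht) (hYne t ht) unitInterval.one_mem)
  · simp only [hconj t ht]
    exact Or.inr (hYd t ht)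
  · simp only [hconj t ht]
    exact Or.inr (hYA t ht)

section DegreeTwo

variable {V : Type*} {G : SimpleGraph V} {S S' : Finset V} {q : V → ℍ[ℝ]}

/-- Every vertex of `S` has at most two neighbours in `S`. -/
def DegLeTwoOn (G : SimpleGraph V) (S : Finset V) : Prop :=
  ∀ v ∈ S, ∀ a ∈ S, ∀ b ∈ S, ∀ c ∈ S, G.Adj v a → G.Adj v b → G.Adj v c → a = b ∨ b = c ∨ a = c

lemma DegLeTwoOn.mono (h : DegLeTwoOn G S) (hS : S' ⊆ S) : DegLeTwoOn G S' :=
  fun v hv a ha b hb c hc => h v (hS hv) a (hS ha) b (hS hb) c (hS hc)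

lemma DegLeTwoOn.sup_edge {u w : V} (h : DegLeTwoOn G S) (hS : S' ⊆ S)
    (hu : ∃ x ∈ S, x ∉ S' ∧ G.Adj u x) (hw : ∃ x ∈ S, x ∉ S' ∧ G.Adj w x) :
    DegLeTwoOn (G ⊔ SimpleGraph.edge u w) S' := by
  have key : ∀ v ∈ S', ∀ x ∈ S, x ∉ S' → G.Adj v x → ∀ a ∈ S', ∀ b ∈ S', G.Adj v a →
      G.Adj v b → a = b := by
    intro v hv x hx hxS hvx a ha b hb hva hvb
    rcases h v (hS hv) x hx a (hS ha) b (hS hb) hvx hva hvb with e | e | e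
    · exact absurd (e ▸ ha) hxS
    · exact e
    · exact absurd (e ▸ hb) hxS
  obtain ⟨x, hx, hxS, hux⟩ := hu
  obtain ⟨y, hy, hyS, hwy⟩ := hw
  intro v hv a ha b hb c hc hva hvb hvc
  have h0 := h v (hS hv) a (hS ha) b (hS hb) c (hS hc)
  simp only [SimpleGraph.sup_adj, SimpleGraph.edge_adj] at hva hvb hvc
  by_cases hvu : v = u
  · subst hvu
    have k := key v hv x hx hxS hux
    by_cases hvw : v = w
    · grind
    · grind
  · by_cases hvw : v = w
    · subst hvw
      have k := key v hv y hy hyS hwy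
      grind
    · grind

lemma SignCommutesOn.sup_edge {u w : V} (h : SignCommutesOn G S q)
    (huw : SignCommute (q u) (q w)) : SignCommutesOn (G ⊔ SimpleGraph.edge u w) S q := by
  intro a ha b hb hab
  rcases hab with hab | hab
  · exact h a ha b hb hab
  · rw [SimpleGraph.edge_adj] at hab
    rcases hab.1 with ⟨rfl, rfl⟩ | ⟨rfl, rfl⟩
    · exact huw
    · exact huw.symm

lemma sup_edge_adj {u w : V} (h : u ≠ w) : (G ⊔ SimpleGraph.edge u w).Adj u w :=
  Or.inr (by rw [SimpleGraph.edge_adj]; exact ⟨Or.inl ⟨rfl, rfl⟩, h⟩)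

lemma eq_or_eq_neg_conj {r a b : ℍ[ℝ]} (h : a = b ∨ a = -b) :
    r * a * r⁻¹ = r * b * r⁻¹ ∨ r * a * r⁻¹ = -(r * b * r⁻¹) := by
  rcases h with rfl | rfl
  · exact Or.inl rfl
  · exact Or.inr (by simp)

lemma conj_anticommute_conj {r a b : ℍ[ℝ]} (hr : r ≠ 0) (h : a * b = -(b * a)) :
    r * a * r⁻¹ * (r * b * r⁻¹) = -(r * b * r⁻¹ * (r * a * r⁻¹)) := by
  have key (a b : ℍ[ℝ]) : r * a * r⁻¹ * (r * b * r⁻¹) = r * (a * b) * r⁻¹ := by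
    simp [mul_assoc, hr]
  rw [key, key, h]
  simp

lemma eq_zero_of_eq_neg {x : ℍ[ℝ]} (h : x = -x) : x = 0 := by
  have h2 : (2 : ℝ) • x = 0 := by rw [two_smul]; nth_rw 2 [h]; abel
  simpa using h2

lemma not_commute_of_anticommute_of_sq {b c : ℍ[ℝ]} (hb : b * b = -1) (hc : c * c = -1)
    (h : c * b = -(b * c)) : c * b ≠ b * c := by
  intro h'
  rw [h'] at h
  rcases mul_eq_zero.mp (eq_zero_of_eq_neg h) with rfl | rfl
  · simp at hb
  · simp at hc

variable [DecidableEq V]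

/-- Adding a vertex with real entry preserves alignability. -/
lemma Alignable.of_erase_real {v : V} (h1 : q v * q v = 1) (h : Alignable G (S.erase v) q) :
    Alignable G S q := by
  have hσ : ∀ R ∈ conjugators G (S.erase v) q, SignCommutesOn G S (conjFun (R ∘ id) q) := by
    intro R hR
    refine hR.2.of_erase fun u hu huv => SignCommute.of_sq_eq_one_left ?_ _
    simp only [conjFun, conj_of_sq_eq_one (hR.1 v) h1, h1]
  refine h.of_pullback id hσ fun R hR hm => alignable_of_mem (hσ R hR) fun u hu => ?_
  by_cases huv : u = v
  · subst huv
    simp only [Function.comp_id, conjFun, conj_of_sq_eq_one (hR.1 u) h1]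
    exact mem_quatGroup_of_sq_eq_one h1
  · exact hm u (Finset.mem_erase.mpr ⟨huv, hu⟩)

/-- Contracting an edge with proportional entries. -/
lemma Alignable.of_contract {u v w : V} (hu : u ∈ S) (hw : w ∈ S)
    (hvw : G.Adj v w) (hvu : G.Adj v u) (huw : u ≠ w)
    (hdeg : ∀ x ∈ S, G.Adj v x → x = w ∨ x = u) (hq : q v = q w ∨ q v = -q w)
    (h : Alignable (G ⊔ SimpleGraph.edge u w) (S.erase v) q) : Alignable G S q := by
  set σ : V → V := fun u => if u = v then w else u with hσdef
  have hσu : ∀ (R : V → ℍ[ℝ]) x, x ≠ v → conjFun (R ∘ σ) q x = conjFun R q x := fun R x hx => by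
    simp [conjFun, hσdef, hx]
  have hσv : ∀ R : V → ℍ[ℝ], conjFun (R ∘ σ) q v = conjFun R q w ∨
      conjFun (R ∘ σ) q v = -conjFun R q w := fun R => by
    simpa [conjFun, hσdef] using eq_or_eq_neg_conj hq
  have hwS : w ∈ S.erase v := Finset.mem_erase.mpr ⟨hvw.ne', hw⟩
  have huS : u ∈ S.erase v := Finset.mem_erase.mpr ⟨hvu.ne', hu⟩
  have hσ : ∀ R ∈ conjugators (G ⊔ SimpleGraph.edge u w) (S.erase v) q,
      SignCommutesOn G S (conjFun (R ∘ σ) q) := by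
    intro R hR
    refine SignCommutesOn.of_erase (v := v) ?_ fun x hx hvx => ?_
    · intro a ha b hb hab
      rw [hσu R a (Finset.ne_of_mem_erase ha), hσu R b (Finset.ne_of_mem_erase hb)]
      exact hR.2 a ha b hb (Or.inl hab)
    · rcases hdeg x hx hvx with rfl | rfl
      · rw [hσu R x hvw.ne']
        exact (SignCommute.refl _).eq_or_eq_neg_left (hσv R)
      · rw [hσu R x hvu.ne']
        exact (hR.2 _ huS _ hwS (sup_edge_adj huw)).symm.eq_or_eq_neg_left (hσv R)
  refine h.of_pullback σ hσ fun R hR hm => alignable_of_mem (hσ R hR) fun x hx => ?_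
  by_cases hxv : x = v
  · subst hxv
    exact mem_quatGroup_of_eq_or_neg (hm w hwS) (hσv R)
  · rw [hσu R x hxv]
    exact hm x (Finset.mem_erase.mpr ⟨hxv, hx⟩)

/-- Contracting a path `v₁ v₂ v₃` whose end entries are proportional. -/
lemma Alignable.of_merge {v₁ v₂ v₃ v₄ : V} (hv₁ : v₁ ∈ S) (hv₂ : v₂ ∈ S) (hv₃ : v₃ ∈ S)
    (hv₄ : v₄ ∈ S) (h₂₁ : G.Adj v₂ v₁) (h₂₃ : G.Adj v₂ v₃) (h₃₄ : G.Adj v₃ v₄)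
    (h13 : v₁ ≠ v₃) (h24 : v₂ ≠ v₄) (h14 : v₁ ≠ v₄)
    (hdeg₂ : ∀ x ∈ S, G.Adj v₂ x → x = v₁ ∨ x = v₃)
    (hdeg₃ : ∀ x ∈ S, G.Adj v₃ x → x = v₂ ∨ x = v₄)
    (hq : SignCommutesOn G S q) (hq₁ : q v₁ * q v₁ = -1) (hq₂ : q v₂ * q v₂ = -1)
    (hq₁₂ : q v₁ * q v₂ = -(q v₂ * q v₁)) (hq₃ : q v₃ = q v₁ ∨ q v₃ = -q v₁)
    (h : SignCommutesOn (G ⊔ SimpleGraph.edge v₁ v₄) ((S.erase v₂).erase v₃) q →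
      Alignable (G ⊔ SimpleGraph.edge v₁ v₄) ((S.erase v₂).erase v₃) q) : Alignable G S q := by
  have h12 : v₁ ≠ v₂ := h₂₁.ne'
  have h23 : v₂ ≠ v₃ := h₂₃.ne
  have h34 : v₃ ≠ v₄ := h₃₄.ne
  set S' := (S.erase v₂).erase v₃ with hS'
  have hS'S : S' ⊆ S := (Finset.erase_subset _ _).trans (Finset.erase_subset _ _)
  have m1 : v₁ ∈ S' := by simp [*]
  have m4 : v₄ ∈ S' := by simp [hS', hv₄, h34.symm, h24.symm]
  have h' := h ((hq.mono hS'S).sup_edge (by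
    have := hq v₃ hv₃ v₄ hv₄ h₃₄
    refine this.eq_or_eq_neg_left ?_
    rcases hq₃ with e | e <;> simp [e]))
  set σ : V → V := fun u => if u = v₂ ∨ u = v₃ then v₁ else u with hσdef
  have hσu : ∀ (R : V → ℍ[ℝ]) x, x ≠ v₂ → x ≠ v₃ → conjFun (R ∘ σ) q x = conjFun R q x :=
    fun R x h2 h3 => by simp [conjFun, hσdef, h2, h3]
  have hσ2 : ∀ R : V → ℍ[ℝ], conjFun (R ∘ σ) q v₂ = R v₁ * q v₂ * (R v₁)⁻¹ := fun R => by
    simp [conjFun, hσdef]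
  have hσ3 : ∀ R : V → ℍ[ℝ], conjFun (R ∘ σ) q v₃ = R v₁ * q v₃ * (R v₁)⁻¹ := fun R => by
    simp [conjFun, hσdef]
  have hσ3' : ∀ R : V → ℍ[ℝ], conjFun (R ∘ σ) q v₃ = conjFun R q v₁ ∨
      conjFun (R ∘ σ) q v₃ = -conjFun R q v₁ := fun R => by
    rw [hσ3]
    exact eq_or_eq_neg_conj hq₃
  have hσ : ∀ R ∈ conjugators (G ⊔ SimpleGraph.edge v₁ v₄) S' q,
      SignCommutesOn G S (conjFun (R ∘ σ) q) := by
    intro R hR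
    have h32 : SignCommute (conjFun (R ∘ σ) q v₃) (conjFun (R ∘ σ) q v₂) := by
      rw [hσ3, hσ2]
      exact (hq v₂ hv₂ v₃ hv₃ h₂₃).symm.conj (hR.1 v₁)
    refine SignCommutesOn.of_erase (v := v₂) (SignCommutesOn.of_erase (v := v₃) ?_ ?_) ?_
    · intro a ha b hb hab
      have ha' := Finset.mem_erase.mp ha
      have hb' := Finset.mem_erase.mp hb
      rw [hσu R a (Finset.ne_of_mem_erase ha'.2) ha'.1, hσu R b (Finset.ne_of_mem_erase hb'.2) hb'.1]
      exact hR.2 a ha b hb (Or.inl hab)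
    · intro x hx hvx
      rcases hdeg₃ x (Finset.mem_of_mem_erase hx) hvx with rfl | rfl
      · exact h32
      · rw [hσu R x h24.symm h34.symm]
        exact (hR.2 _ m1 _ m4 (sup_edge_adj h14)).eq_or_eq_neg_left (hσ3' R)
    · intro x hx hvx
      rcases hdeg₂ x hx hvx with rfl | rfl
      · rw [hσu R x h12 h13, hσ2]
        exact (hq v₂ hv₂ x hx hvx).conj (hR.1 x)
      · exact h32.symm
  refine h'.of_pullback σ hσ fun R hR hm => ?_
  have e1 : conjFun (R ∘ σ) q v₁ = conjFun R q v₁ := hσu R v₁ h12 h13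
  refine alignable_of_neighbors_eq (v := v₂) (c := conjFun R q v₁) (hσ R hR) ?_ ?_ (hm v₁ m1)
    ?_ ?_ ?_
  · rw [hσ2]
    exact conj_sq_eq_neg_one (hR.1 _) hq₂
  · exact conj_sq_eq_neg_one (hR.1 _) hq₁
  · rw [hσ2]
    exact conj_anticommute_conj (hR.1 _) hq₁₂
  · intro u hu hvu
    rcases hdeg₂ u hu hvu with rfl | rfl
    · exact Or.inl e1
    · exact hσ3' R
  · intro u hu hu2
    by_cases hu3 : u = v₃
    · subst hu3
      exact mem_quatGroup_of_eq_or_neg (hm v₁ m1) (hσ3' R)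
    · rw [hσu R u hu2 hu3]
      exact hm u (by simp [*])

lemma mem_quatGroup_of_anticommute {b c d : ℍ[ℝ]} (hb : b ∈ quatGroup) (hc : c ∈ quatGroup)
    (hb2 : b * b = -1) (hc2 : c * c = -1) (hd2 : d * d = -1) (hcb : c * b = -(b * c))
    (hdb : d * b = -(b * d)) (hdc : d * c = -(c * d)) : d ∈ quatGroup := by
  have ne0 : ∀ {x : ℍ[ℝ]} {n : Fin 4}, x * x = -1 → (x = basisQuat n ∨ x = -basisQuat n) →
      n ≠ 0 := by
    rintro x n hx hn rfl
    have h1 : basisQuat 0 = 1 := by ext <;> simp [basisQuat]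
    rw [h1] at hn
    rcases hn with rfl | rfl <;>
    · have := congrArg (·.re) hx
      norm_num at this
  obtain ⟨m, hm⟩ := hb
  obtain ⟨n, hn⟩ := hc
  have hm0 := ne0 hb2 hm
  have hn0 := ne0 hc2 hn
  have hcb0 := not_commute_of_anticommute_of_sq hb2 hc2 hcb
  have hmn : m ≠ n := by
    rintro rfl
    apply hcb0
    rcases hm with rfl | rfl <;> rcases hn with rfl | rfl <;> simp
  obtain ⟨l, hl0, hlm, hln⟩ : ∃ l : Fin 4, l ≠ 0 ∧ l ≠ m ∧ l ≠ n := by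
    clear * - hm0
    decide +revert
  have e1 : basisQuat l * c = -(c * basisQuat l) := by
    rcases hn with rfl | rfl <;> simp [basisQuat_anticommute hl0 hn0 hln]
  have e2 : basisQuat l * b = -(b * basisQuat l) := by
    rcases hm with rfl | rfl <;> simp [basisQuat_anticommute hl0 hm0 hlm]
  exact ⟨l, eq_or_eq_neg_of_anticommute hc2 hb2 hd2 (basisQuat_sq hl0) hdc hdb e1 e2 hcb0⟩

/-- Adding the remaining two vertices of a triangle with anticommuting entries. -/
lemma Alignable.of_triangle {v₁ v₂ v₃ : V} (hv₁ : v₁ ∈ S) (hv₂ : v₂ ∈ S) (hv₃ : v₃ ∈ S)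
    (h12 : v₁ ≠ v₂) (h13 : v₁ ≠ v₃) (h₂₃ : G.Adj v₂ v₃)
    (hdeg₂ : ∀ x ∈ S, G.Adj v₂ x → x = v₁ ∨ x = v₃)
    (hdeg₃ : ∀ x ∈ S, G.Adj v₃ x → x = v₁ ∨ x = v₂)
    (hq₁ : q v₁ * q v₁ = -1) (hq₂ : q v₂ * q v₂ = -1) (hq₃ : q v₃ * q v₃ = -1)
    (h₁₂ : q v₁ * q v₂ = -(q v₂ * q v₁)) (h₁₃ : q v₁ * q v₃ = -(q v₃ * q v₁))
    (h₃₂ : q v₃ * q v₂ = -(q v₂ * q v₃))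
    (h : Alignable G ((S.erase v₂).erase v₃) q) : Alignable G S q := by
  have h23 : v₂ ≠ v₃ := h₂₃.ne
  have m1 : v₁ ∈ (S.erase v₂).erase v₃ := by simp [*]
  have key : ∀ p : V → ℍ[ℝ], SignCommutesOn G ((S.erase v₂).erase v₃) p →
      SignCommute (p v₁) (p v₂) → SignCommute (p v₁) (p v₃) → SignCommute (p v₃) (p v₂) →
      SignCommutesOn G S p := by
    intro p hp k12 k13 k32
    refine SignCommutesOn.of_erase (v := v₂) (SignCommutesOn.of_erase (v := v₃) hp ?_) ?_
    · intro x hx hvx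
      rcases hdeg₃ x (Finset.mem_of_mem_erase hx) hvx with rfl | rfl
      exacts [k13.symm, k32]
    · intro x hx hvx
      rcases hdeg₂ x hx hvx with rfl | rfl
      exacts [k12.symm, k32.symm]
  set σ : V → V := fun u => if u = v₂ ∨ u = v₃ then v₁ else u with hσdef
  have hσu : ∀ (R : V → ℍ[ℝ]) x, x ≠ v₂ → x ≠ v₃ → conjFun (R ∘ σ) q x = conjFun R q x :=
    fun R x h2 h3 => by simp [conjFun, hσdef, h2, h3]
  have hσ1 : ∀ R : V → ℍ[ℝ], conjFun (R ∘ σ) q v₁ = R v₁ * q v₁ * (R v₁)⁻¹ := fun R =>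
    hσu R v₁ h12 h13
  have hσ2 : ∀ R : V → ℍ[ℝ], conjFun (R ∘ σ) q v₂ = R v₁ * q v₂ * (R v₁)⁻¹ := fun R => by
    simp [conjFun, hσdef]
  have hσ3 : ∀ R : V → ℍ[ℝ], conjFun (R ∘ σ) q v₃ = R v₁ * q v₃ * (R v₁)⁻¹ := fun R => by
    simp [conjFun, hσdef]
  have hσ : ∀ R ∈ conjugators G ((S.erase v₂).erase v₃) q,
      SignCommutesOn G S (conjFun (R ∘ σ) q) := by
    intro R hR
    refine key _ ?_ ?_ ?_ ?_
    · intro a ha b hb hab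
      have ha' := Finset.mem_erase.mp ha
      have hb' := Finset.mem_erase.mp hb
      rw [hσu R a (Finset.ne_of_mem_erase ha'.2) ha'.1, hσu R b (Finset.ne_of_mem_erase hb'.2) hb'.1]
      exact hR.2 a ha b hb hab
    · rw [hσ1, hσ2]
      exact SignCommute.conj (hR.1 _) (Or.inr h₁₂)
    · rw [hσ1, hσ3]
      exact SignCommute.conj (hR.1 _) (Or.inr h₁₃)
    · rw [hσ3, hσ2]
      exact SignCommute.conj (hR.1 _) (Or.inr h₃₂)
  refine h.of_pullback σ hσ fun R hR hm => ?_
  have hp := hσ R hR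
  have hm' : ∀ u ∈ S, u ≠ v₂ → u ≠ v₃ → conjFun (R ∘ σ) q u ∈ quatGroup := fun u hu h2 h3 => by
    rw [hσu R u h2 h3]
    exact hm u (by simp [*])
  have p1 := conj_sq_eq_neg_one (hR.1 v₁) hq₁
  have p2 := conj_sq_eq_neg_one (hR.1 v₁) hq₂
  have p3 := conj_sq_eq_neg_one (hR.1 v₁) hq₃
  have k12 := conj_anticommute_conj (hR.1 v₁) h₁₂
  have k13 := conj_anticommute_conj (hR.1 v₁) h₁₃
  have k32 := conj_anticommute_conj (hR.1 v₁) h₃₂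
  rw [← hσ1] at p1 k12 k13
  rw [← hσ2] at p2 k12 k32
  rw [← hσ3] at p3 k13 k32
  generalize conjFun (R ∘ σ) q = p at *
  have c1 := hm' v₁ hv₁ h12 h13
  obtain ⟨b, hbm, hb, hcb, hne⟩ : ∃ b ∈ quatGroup, b * b = -1 ∧ p v₁ * b = -(b * p v₁) ∧
      b ≠ -p v₂ := by
    obtain ⟨b, hbm, hb, hcb⟩ := exists_quatGroup_anticommute c1 p1
    by_cases e : b = -p v₂
    · refine ⟨p v₂, mem_quatGroup_of_eq_or_neg hbm (Or.inr (by simp [e])), p2, k12, fun h => ?_⟩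
      have h0 : p v₂ = 0 := eq_zero_of_eq_neg h
      simp [h0] at p2
    · exact ⟨b, hbm, hb, hcb, e⟩
  set r := rotor (p v₂) b with hr
  have hr0 : ∀ t ∈ unitInterval, r t ≠ 0 := fun t ht => rotor_ne_zero p2 hb hne ht
  have hrc : ∀ t, r t * p v₁ = p v₁ * r t := fun t => rotor_commute k12 hcb t
  set f : ℝ → V → ℍ[ℝ] := fun t u => if u = v₂ ∨ u = v₃ then r t else 1 with hf
  have f2 : ∀ t, conjFun (f t) p v₂ = r t * p v₂ * (r t)⁻¹ := fun t => by simp [conjFun, hf]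
  have f3 : ∀ t, conjFun (f t) p v₃ = r t * p v₃ * (r t)⁻¹ := fun t => by simp [conjFun, hf]
  have fu : ∀ t u, u ≠ v₂ → u ≠ v₃ → conjFun (f t) p u = p u := fun t u h2 h3 => by
    simp [conjFun, hf, h2, h3]
  have hJ : JoinedIn (conjugators G S p) 1 (f 1) := by
    refine joinedIn_conjugators ?_ ?_ ?_ ?_
    · intro u
      simp only [hf]
      split_ifs
      · exact (continuous_rotor _ _).continuousOn
      · exact continuousOn_const
    · funext u
      simp [hf, hr]
    · intro t ht u
      simp only [hf]
      split_ifs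
      · exact hr0 t ht
      · exact one_ne_zero
    · intro t ht
      refine key _ ?_ ?_ ?_ ?_
      · intro a ha b hb hab
        simp only [Finset.mem_erase] at ha hb
        rw [fu t a ha.2.1 ha.1, fu t b hb.2.1 hb.1]
        exact hp a ha.2.2 b hb.2.2 hab
      · rw [fu t _ h12 h13, f2]
        exact Or.inr (conj_anticommute (hr0 t ht) (hrc t) k12)
      · rw [fu t _ h12 h13, f3]
        exact Or.inr (conj_anticommute (hr0 t ht) (hrc t) k13)
      · rw [f2, f3]
        exact SignCommute.conj (hr0 t ht) (Or.inr k32)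
  refine Alignable.of_joinedIn hJ (alignable_of_mem hJ.target_mem.2 fun u hu => ?_)
  have i1 := unitInterval.one_mem
  have e2 : r 1 * p v₂ * (r 1)⁻¹ = b := rotor_one_conj p2 hb hne
  by_cases hu2 : u = v₂
  · subst hu2
    rwa [f2, e2]
  by_cases hu3 : u = v₃
  · subst hu3
    rw [f3]
    refine mem_quatGroup_of_anticommute hbm c1 hb p1 (conj_sq_eq_neg_one (hr0 1 i1) p3) hcb ?_ ?_
    · rw [← e2]
      exact conj_anticommute_conj (hr0 1 i1) k32
    · rw [conj_anticommute (hr0 1 i1) (hrc 1) k13, neg_neg]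
  · rw [fu 1 u hu2 hu3]
    exact hm' u hu hu2 hu3

end DegreeTwo

section DegreeTwoInduction

variable {V : Type*} [DecidableEq V] {G : SimpleGraph V} {S : Finset V} {q : V → ℍ[ℝ]}

/-- Making the end entries of a path `v₁ v₂ v₃ v₄ v₅` of anticommuting entries satisfy
`q v₃ = q v₁`, and then contracting. -/
lemma Alignable.of_path {v₁ v₂ v₃ v₄ v₅ : V} (hv₁ : v₁ ∈ S) (hv₂ : v₂ ∈ S) (hv₃ : v₃ ∈ S)
    (hv₄ : v₄ ∈ S) (hv₅ : v₅ ∈ S) (h₂₁ : G.Adj v₂ v₁) (h₂₃ : G.Adj v₂ v₃) (h₃₄ : G.Adj v₃ v₄)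
    (h₄₅ : G.Adj v₄ v₅) (h13 : v₁ ≠ v₃) (h24 : v₂ ≠ v₄) (h14 : v₁ ≠ v₄) (h35 : v₃ ≠ v₅)
    (hdeg₂ : ∀ x ∈ S, G.Adj v₂ x → x = v₁ ∨ x = v₃)
    (hdeg₃ : ∀ x ∈ S, G.Adj v₃ x → x = v₂ ∨ x = v₄)
    (hdeg₄ : ∀ x ∈ S, G.Adj v₄ x → x = v₃ ∨ x = v₅)
    (hq : SignCommutesOn G S q) (hp : RealOrPureOn S q)
    (hpure : ∀ v ∈ S, q v * q v = -1)
    (hanti : ∀ a ∈ S, ∀ b ∈ S, G.Adj a b → q a * q b = -(q b * q a))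
    (hq₃₅ : ¬(q v₃ = q v₅ ∨ q v₃ = -q v₅))
    (h : ∀ p, RealOrPureOn ((S.erase v₂).erase v₃) p →
      SignCommutesOn (G ⊔ SimpleGraph.edge v₁ v₄) ((S.erase v₂).erase v₃) p →
      Alignable (G ⊔ SimpleGraph.edge v₁ v₄) ((S.erase v₂).erase v₃) p) : Alignable G S q := by
  have h12 : v₁ ≠ v₂ := h₂₁.ne'
  have h23 : v₂ ≠ v₃ := h₂₃.ne
  have h34 : v₃ ≠ v₄ := h₃₄.ne
  have hS'S : (S.erase v₂).erase v₃ ⊆ S :=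
    (Finset.erase_subset _ _).trans (Finset.erase_subset _ _)
  have merge : ∀ p : V → ℍ[ℝ], SignCommutesOn G S p → RealOrPureOn S p → p v₁ = q v₁ →
      p v₂ = q v₂ → (p v₃ = p v₁ ∨ p v₃ = -p v₁) → Alignable G S p := by
    intro p hp1 hp2 e1 e2 e3
    refine Alignable.of_merge hv₁ hv₂ hv₃ hv₄ h₂₁ h₂₃ h₃₄ h13 h24 h14 hdeg₂ hdeg₃ hp1
      (by rw [e1]; exact hpure _ hv₁) (by rw [e2]; exact hpure _ hv₂)
      (by rw [e1, e2]; exact hanti _ hv₁ _ hv₂ h₂₁.symm) e3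
      (h p fun v hv => hp2 v (hS'S hv))
  by_cases h31 : q v₃ = q v₁ ∨ q v₃ = -q v₁
  · exact merge q hq hp rfl rfl h31
  have hne : q v₁ ≠ -q v₃ := fun e => h31 (Or.inr (by rw [e, neg_neg]))
  have a21 := hanti _ hv₂ _ hv₁ h₂₁
  have a23 := hanti _ hv₂ _ hv₃ h₂₃
  by_cases h42 : q v₄ = q v₂ ∨ q v₄ = -q v₂
  · refine Alignable.of_update (v := v₃) (b := q v₁) hq (hpure _ hv₃) (hpure _ hv₁) hne ?_ ?_
    · intro u hu hvu
      right
      rcases hdeg₃ u hu hvu with rfl | rfl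
      · exact ⟨a23, a21⟩
      · rcases h42 with e | e <;> simp [e, a23, a21]
    · intro hup
      refine merge _ hup ?_ ?_ ?_ ?_
      · intro v hv
        by_cases e : v = v₃
        · subst e
          exact Or.inr (by simpa using hpure _ hv₁)
        · simpa [e] using hp v hv
      · simp [h13]
      · simp [h23]
      · simp [h13]
  obtain ⟨r, hrc, hr0, hr⟩ := exists_following_rotor (a := q v₃) (b := q v₄) (c := q v₂)
    (d := q v₅) (e := q v₁) (hpure _ hv₃) (hpure _ hv₄) (hpure _ hv₂) (hpure _ hv₅) (hpure _ hv₁)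
    (hanti _ hv₄ _ hv₃ h₃₄.symm) (hanti _ hv₄ _ hv₅ h₄₅) a23 a21
    (fun e => hq₃₅ (eq_or_eq_neg_of_commute (hpure _ hv₃) (hpure _ hv₅) e))
    (fun e => h42 (Or.inl e)) (fun e => h42 (Or.inr e)) hne
  have hs0 : ∀ t ∈ unitInterval, rotor (q v₃) (q v₁) t ≠ 0 := fun t ht =>
    rotor_ne_zero (hpure _ hv₃) (hpure _ hv₁) hne ht
  set f : ℝ → V → ℍ[ℝ] := fun t u =>
    if u = v₃ then rotor (q v₃) (q v₁) t else if u = v₄ then r t else 1 with hf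
  have f3 : ∀ t, conjFun (f t) q v₃ =
      rotor (q v₃) (q v₁) t * q v₃ * (rotor (q v₃) (q v₁) t)⁻¹ := fun t => by simp [conjFun, hf]
  have f4 : ∀ t, conjFun (f t) q v₄ = r t * q v₄ * (r t)⁻¹ := fun t => by
    simp [conjFun, hf, h34.symm]
  have fu : ∀ t u, u ≠ v₃ → u ≠ v₄ → conjFun (f t) q u = q u := fun t u h3 h4 => by
    simp [conjFun, hf, h3, h4]
  have hf0 : ∀ t ∈ unitInterval, ∀ v, f t v ≠ 0 := by
    intro t ht u
    simp only [hf]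
    split_ifs
    · exact hs0 t ht
    · exact (hr t ht).1
    · exact one_ne_zero
  have hJ : JoinedIn (conjugators G S q) 1 (f 1) := by
    refine joinedIn_conjugators ?_ ?_ hf0 ?_
    · intro u
      simp only [hf]
      split_ifs
      · exact (continuous_rotor _ _).continuousOn
      · exact hrc
      · exact continuousOn_const
    · funext u
      simp [hf, hr0]
    · intro t ht
      have k34 : SignCommute (conjFun (f t) q v₄) (conjFun (f t) q v₃) := by
        rw [f3, f4]
        exact (hr t ht).2.2
      refine SignCommutesOn.of_erase (v := v₃) (SignCommutesOn.of_erase (v := v₄) ?_ ?_) ?_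
      · intro a ha b hb hab
        simp only [Finset.mem_erase] at ha hb
        rw [fu t a ha.2.1 ha.1, fu t b hb.2.1 hb.1]
        exact hq a ha.2.2 b hb.2.2 hab
      · intro x hx hvx
        rcases hdeg₄ x (Finset.mem_of_mem_erase hx) hvx with rfl | rfl
        · exact k34
        · rw [f4, fu t x h35.symm h₄₅.ne']
          exact (hr t ht).2.1
      · intro x hx hvx
        rcases hdeg₃ x hx hvx with rfl | rfl
        · rw [f3, fu t x h23 h24]
          exact SignCommute.symm (Or.inr (conj_anticommute (hs0 t ht) (rotor_commute a23 a21 t) a23))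
        · exact k34.symm
  have i1 : (1 : ℝ) ∈ unitInterval := unitInterval.one_mem
  refine Alignable.of_joinedIn hJ (merge _ hJ.target_mem.2 (hp.conjFun (hf0 1 i1))
    (fu 1 _ h13 h14) (fu 1 _ h23 h24) (Or.inl ?_))
  rw [f3, fu 1 _ h13 h14]
  exact rotor_one_conj (hpure _ hv₃) (hpure _ hv₁) hne

theorem alignable_of_degLeTwoOn (hdeg : DegLeTwoOn G S) (hq : SignCommutesOn G S q)
    (hp : RealOrPureOn S q) : Alignable G S q := by
  induction hn : S.card using Nat.strong_induction_on generalizing G S q with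
  | _ n IH =>
  have IH' : ∀ (G' : SimpleGraph V) (S' : Finset V) (p : V → ℍ[ℝ]), S' ⊂ S → DegLeTwoOn G' S' →
      SignCommutesOn G' S' p → RealOrPureOn S' p → Alignable G' S' p :=
    fun G' S' p hS' h1 h2 h3 => IH _ (hn ▸ Finset.card_lt_card hS') h1 h2 h3 rfl
  have mono : ∀ {S' : Finset V} {p : V → ℍ[ℝ]}, S' ⊆ S → RealOrPureOn S p → RealOrPureOn S' p :=
    fun hS h v hv => h v (hS hv)
  clear IH
  by_cases hreal : ∃ v ∈ S, q v * q v = 1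
  · obtain ⟨v, hv, h1⟩ := hreal
    have hS := Finset.erase_ssubset hv
    exact Alignable.of_erase_real h1
      (IH' _ _ _ hS (hdeg.mono hS.1) (hq.mono hS.1) (mono hS.1 hp))
  push Not at hreal
  have hpure : ∀ v ∈ S, q v * q v = -1 := fun v hv => (hp v hv).resolve_left (hreal v hv)
  by_cases hleaf : ∃ v ∈ S, ∀ a ∈ S, ∀ b ∈ S, G.Adj v a → G.Adj v b → a = b
  · obtain ⟨v, hv, h1⟩ := hleaf
    have hS := Finset.erase_ssubset hv
    exact Alignable.of_erase hv h1 hq hp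
      (IH' _ _ _ hS (hdeg.mono hS.1) (hq.mono hS.1) (mono hS.1 hp))
  push Not at hleaf
  have other : ∀ v ∈ S, ∀ a ∈ S, G.Adj v a → ∃ b ∈ S, b ≠ a ∧ G.Adj v b ∧
      ∀ x ∈ S, G.Adj v x → x = a ∨ x = b := by
    intro v hv a ha hva
    obtain ⟨b, hb, c, hc, hvb, hvc, hbc⟩ := hleaf v hv
    have key : ∀ y ∈ S, G.Adj v y → y ≠ a → ∃ b ∈ S, b ≠ a ∧ G.Adj v b ∧
        ∀ x ∈ S, G.Adj v x → x = a ∨ x = b := by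
      intro y hy hvy hya
      refine ⟨y, hy, hya, hvy, fun x hx hvx => ?_⟩
      rcases hdeg v hv a ha y hy x hx hva hvy hvx with e | e | e
      · exact absurd e.symm hya
      · exact Or.inr e.symm
      · exact Or.inl e.symm
    by_cases hba : b = a
    · exact key c hc hvc fun h => hbc (hba.trans h.symm)
    · exact key b hb hvb hba
  by_cases hcomm : ∃ v ∈ S, ∃ w ∈ S, G.Adj v w ∧ q v * q w = q w * q v
  · obtain ⟨v, hv, w, hw, hvw, hc⟩ := hcomm
    obtain ⟨u, hu, huw, hvu, hx⟩ := other v hv w hw hvw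
    have he := eq_or_eq_neg_of_commute (hpure v hv) (hpure w hw) hc
    have hS := Finset.erase_ssubset hv
    refine Alignable.of_contract hu hw hvw hvu huw hx he (IH' _ _ _ hS ?_ ?_ (mono hS.1 hp))
    · exact hdeg.sup_edge hS.1 ⟨v, hv, by simp, hvu.symm⟩ ⟨v, hv, by simp, hvw.symm⟩
    · refine (hq.mono hS.1).sup_edge ?_
      refine ((hq v hv u hu hvu).eq_or_eq_neg_left ?_).symm
      rcases he with e | e <;> simp [e]
  push Not at hcomm
  have hanti : ∀ a ∈ S, ∀ b ∈ S, G.Adj a b → q a * q b = -(q b * q a) := fun a ha b hb hab =>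
    (hq a ha b hb hab).resolve_left (hcomm a ha b hb hab)
  rcases S.eq_empty_or_nonempty with rfl | ⟨v₂, hv₂⟩
  · exact alignable_of_mem hq (by simp)
  obtain ⟨v₁, hv₁, v₃, hv₃, h₂₁, h₂₃, h13⟩ := hleaf v₂ hv₂
  have hdeg₂ : ∀ x ∈ S, G.Adj v₂ x → x = v₁ ∨ x = v₃ := fun x hx hvx => by
    rcases hdeg v₂ hv₂ v₁ hv₁ v₃ hv₃ x hx h₂₁ h₂₃ hvx with e | e | e
    exacts [absurd e h13, Or.inr e.symm, Or.inl e.symm]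
  obtain ⟨v₄, hv₄, h42, h₃₄, hdeg₃⟩ := other v₃ hv₃ v₂ hv₂ h₂₃.symm
  have erase2 : ∀ a ∈ S, ∀ b, (S.erase a).erase b ⊂ S := fun a ha b =>
    (Finset.erase_subset _ _).trans_ssubset (Finset.erase_ssubset ha)
  by_cases h41 : v₄ = v₁
  · subst h41
    have hS := erase2 v₂ hv₂ v₃
    exact Alignable.of_triangle hv₁ hv₂ hv₃ h42 h13 h₂₃ hdeg₂ (fun x hx h => (hdeg₃ x hx h).symm)
      (hpure _ hv₁) (hpure _ hv₂) (hpure _ hv₃) (hanti _ hv₁ _ hv₂ h₂₁.symm)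
      (hanti _ hv₁ _ hv₃ h₃₄.symm) (hanti _ hv₃ _ hv₂ h₂₃.symm)
      (IH' _ _ _ hS (hdeg.mono hS.1) (hq.mono hS.1) (mono hS.1 hp))
  obtain ⟨v₅, hv₅, h53, h₄₅, hdeg₄⟩ := other v₄ hv₄ v₃ hv₃ h₃₄.symm
  have h52 : v₅ ≠ v₂ := by
    rintro rfl
    rcases hdeg₂ v₄ hv₄ h₄₅.symm with e | e
    exacts [h41 e, h₃₄.ne' e]
  by_cases h35 : q v₃ = q v₅ ∨ q v₃ = -q v₅
  · have hS := erase2 v₄ hv₄ v₃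
    refine Alignable.of_merge hv₅ hv₄ hv₃ hv₂ h₄₅ h₃₄.symm h₂₃.symm h53 h42 h52
      (fun x hx h => (hdeg₄ x hx h).symm) (fun x hx h => (hdeg₃ x hx h).symm) hq (hpure _ hv₅)
      (hpure _ hv₄) (hanti _ hv₅ _ hv₄ h₄₅.symm) h35 fun h => IH' _ _ _ hS ?_ h (mono hS.1 hp)
    exact hdeg.sup_edge hS.1 ⟨v₄, hv₄, by simp, h₄₅.symm⟩ ⟨v₃, hv₃, by simp, h₂₃⟩
  · have hS := erase2 v₂ hv₂ v₃
    refine Alignable.of_path hv₁ hv₂ hv₃ hv₄ hv₅ h₂₁ h₂₃ h₃₄ h₄₅ h13 h42.symm (Ne.symm h41)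
      h53.symm hdeg₂ hdeg₃ hdeg₄ hq hp hpure hanti h35 fun p hp' hq' => IH' _ _ _ hS ?_ hq' hp'
    exact hdeg.sup_edge hS.1 ⟨v₂, hv₂, by simp, h₂₁.symm⟩ ⟨v₃, hv₃, by simp, h₃₄.symm⟩

end DegreeTwoInduction

section Structure

lemma exists_adj_subsingleton_of_isAcyclic {W : Type*} [Finite W] [Nonempty W] {H : SimpleGraph W}
    (h : H.IsAcyclic) : ∃ v, ∀ a b, H.Adj v a → H.Adj v b → a = b := by
  obtain ⟨u, v, p, hp, hmax⟩ := SimpleGraph.Walk.exists_isPath_forall_isPath_length_le_length H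
  have key : ∀ w, H.Adj u w → w = p.snd := by
    intro w hadj
    apply h.eq_snd_of_adj_start hp hadj
    have : ¬(p.cons hadj.symm).IsPath := by grind [SimpleGraph.Walk.length_cons]
    grind [hp.cons]
  exact ⟨u, fun a b ha hb => (key a ha).trans (key b hb).symm⟩

lemma cycleGraph_adj_or {n : ℕ} {v a b c : Fin n} (ha : (SimpleGraph.cycleGraph n).Adj v a)
    (hb : (SimpleGraph.cycleGraph n).Adj v b) (hc : (SimpleGraph.cycleGraph n).Adj v c) :
    a = b ∨ b = c ∨ a = c := by
  match n with
  | 0 => exact v.elim0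
  | 1 => exact Or.inl (Subsingleton.elim _ _)
  | n + 2 =>
    have key : ∀ x, (SimpleGraph.cycleGraph (n + 2)).Adj v x → x = v - 1 ∨ x = v + 1 := by
      intro x hx
      have : x ∈ (SimpleGraph.cycleGraph (n + 2)).neighborSet v := hx
      rwa [SimpleGraph.cycleGraph_neighborSet] at this
    rcases key a ha with rfl | rfl <;> rcases key b hb with rfl | rfl <;>
      rcases key c hc with rfl | rfl <;> simp

variable {V : Type*}

/-- Every finite set of vertices strictly containing `B` has, outside `B`, a vertex with at most
one neighbour in the set and none in `B`. -/
def PeelsTo (G : SimpleGraph V) (B : Finset V) : Prop :=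
  ∀ T, B ⊂ T → ∃ v ∈ T, v ∉ B ∧ (∀ u ∈ B, ¬G.Adj v u) ∧
    ∀ a ∈ T, ∀ b ∈ T, G.Adj v a → G.Adj v b → a = b

lemma exists_degLeTwoOn_peelsTo [Fintype V] (K : SimpleGraph V)
    (hK : ∀ c : K.ConnectedComponent,
      (K.induce c.supp).IsTree ∨
      (∃ n : ℕ, 3 ≤ n ∧ Nonempty (K.induce c.supp ≃g SimpleGraph.cycleGraph n))) :
    ∃ B : Finset V, DegLeTwoOn K B ∧ PeelsTo K B := by
  classical
  have hadj : ∀ {v a : V}, K.Adj v a → K.connectedComponentMk v = K.connectedComponentMk a :=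
    fun h => SimpleGraph.ConnectedComponent.eq.mpr h.reachable
  refine ⟨Finset.univ.filter fun v => ¬(K.induce (K.connectedComponentMk v).supp).IsTree, ?_, ?_⟩
  · intro v hv a _ b _ c _ hva hvb hvc
    simp only [Finset.mem_filter, Finset.mem_univ, true_and] at hv
    obtain ⟨n, -, ⟨e⟩⟩ := (hK (K.connectedComponentMk v)).resolve_left hv
    have key : ∀ x y (hx : K.Adj v x) (hy : K.Adj v y),
        e ⟨x, (hadj hx).symm⟩ = e ⟨y, (hadj hy).symm⟩ → x = y := by
      intro x y hx hy h
      exact congrArg Subtype.val (e.injective h)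
    have hm : ∀ x (hx : K.Adj v x),
        (SimpleGraph.cycleGraph n).Adj (e ⟨v, rfl⟩) (e ⟨x, (hadj hx).symm⟩) := by
      intro x hx
      rw [e.map_adj_iff]
      exact hx
    rcases cycleGraph_adj_or (hm a hva) (hm b hvb) (hm c hvc) with h | h | h
    · exact Or.inl (key _ _ hva hvb h)
    · exact Or.inr (Or.inl (key _ _ hvb hvc h))
    · exact Or.inr (Or.inr (key _ _ hva hvc h))
  · intro T hT
    obtain ⟨x, hxT, hxB⟩ := Finset.exists_of_ssubset hT
    simp only [Finset.mem_filter, Finset.mem_univ, true_and, not_not] at hxB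
    set c := K.connectedComponentMk x with hc
    have hsub : {v | v ∈ T ∧ v ∈ c.supp} ⊆ c.supp := fun v hv => hv.2
    have : Nonempty {v | v ∈ T ∧ v ∈ c.supp} := ⟨⟨x, hxT, rfl⟩⟩
    have hac : (K.induce {v | v ∈ T ∧ v ∈ c.supp}).IsAcyclic :=
      hxB.isAcyclic.embedding (SimpleGraph.induceHomOfLE K hsub)
    obtain ⟨⟨v, hvT, hvc⟩, hv⟩ := exists_adj_subsingleton_of_isAcyclic hac
    have hvc' : K.connectedComponentMk v = c := hvc
    have hcomp : ∀ {a}, K.Adj v a → a ∈ c.supp := fun h => (hadj h).symm.trans hvc'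
    refine ⟨v, hvT, ?_, ?_, ?_⟩
    · simp only [Finset.mem_filter, Finset.mem_univ, true_and, not_not]
      rw [hvc']
      exact hxB
    · intro u hu hvu
      simp only [Finset.mem_filter, Finset.mem_univ, true_and] at hu
      rw [← hadj hvu, hvc'] at hu
      exact hu hxB
    · intro a ha b hb hva hvb
      exact congrArg Subtype.val (hv ⟨a, ha, hcomp hva⟩ ⟨b, hb, hcomp hvb⟩ hva hvb)

lemma exists_forall_ne {X : V → Prop} (f : V → Fin 3)
    (hX : ∀ a b c, X a → X b → X c → a = b ∨ b = c ∨ a = c) : ∃ c, ∀ x, X x → f x ≠ c := by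
  by_contra! h
  obtain ⟨a, ha, ha'⟩ := h 0
  obtain ⟨b, hb, hb'⟩ := h 1
  obtain ⟨c, hc, hc'⟩ := h 2
  rcases hX a b c ha hb hc with rfl | rfl | rfl
  · rw [ha'] at hb'; exact absurd hb' (by decide)
  · rw [hb'] at hc'; exact absurd hc' (by decide)
  · rw [ha'] at hc'; exact absurd hc' (by decide)

variable [DecidableEq V] {G : SimpleGraph V} {S B : Finset V}

/-- Induction principle along peelable vertices. -/
lemma PeelsTo.induction (h : PeelsTo G B) {P : Finset V → Prop} (hB : P B)
    (hstep : ∀ T, B ⊂ T → ∀ v ∈ T, v ∉ B → (∀ u ∈ B, ¬G.Adj v u) →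
      (∀ a ∈ T, ∀ b ∈ T, G.Adj v a → G.Adj v b → a = b) → P (T.erase v) → P T)
    {T : Finset V} (hT : B ⊆ T) : P T := by
  induction hn : T.card generalizing T with
  | zero =>
    obtain rfl := Finset.card_eq_zero.mp hn
    rwa [Finset.subset_empty.mp hT] at hB
  | succ n ih =>
    rcases hT.eq_or_ssubset with rfl | hT'
    · exact hB
    · obtain ⟨v, hv, hvB, h1, h2⟩ := h T hT'
      refine hstep T hT' v hv hvB h1 h2 (ih ?_ ?_)
      · intro u hu
        exact Finset.mem_erase.mpr ⟨fun e => hvB (e ▸ hu), hT hu⟩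
      · rw [Finset.card_erase_of_mem hv, hn]
        rfl

lemma alignable_of_peelsTo (hG : DegLeTwoOn G B) (h : PeelsTo G B) {T : Finset V} (hT : B ⊆ T)
    {q : V → ℍ[ℝ]} (hq : SignCommutesOn G T q) (hp : RealOrPureOn T q) : Alignable G T q := by
  refine h.induction (P := fun T => SignCommutesOn G T q → RealOrPureOn T q → Alignable G T q)
    (alignable_of_degLeTwoOn hG) ?_ hT hq hp
  intro T _ v hv _ _ hleaf ih hq hp
  exact Alignable.of_erase hv hleaf hq hp (ih (hq.mono (Finset.erase_subset _ _))
    fun u hu => hp u (Finset.mem_of_mem_erase hu))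

/-- A graph of maximal degree two whose edges of a given kind form a matching has a vertex
colouring by three colours such that the edges of that kind are the monochromatic ones. -/
lemma exists_three_colouring {P : V → V → Prop} (hP : ∀ a b, P a b → P b a)
    (hG : DegLeTwoOn G S)
    (hm : ∀ v ∈ S, ∀ a ∈ S, ∀ b ∈ S, G.Adj v a → G.Adj v b → P v a → P v b → a = b) :
    ∃ f : V → Fin 3, ∀ a ∈ S, ∀ b ∈ S, G.Adj a b → (f a = f b ↔ P a b) := by
  induction hn : S.card using Nat.strong_induction_on generalizing S with
  | _ n IH =>
  have IH' : ∀ S' : Finset V, S' ⊂ S →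
      ∃ f : V → Fin 3, ∀ a ∈ S', ∀ b ∈ S', G.Adj a b → (f a = f b ↔ P a b) :=
    fun S' hS' => IH _ (hn ▸ Finset.card_lt_card hS') (hG.mono hS'.1)
      (fun v hv a ha b hb => hm v (hS'.1 hv) a (hS'.1 ha) b (hS'.1 hb)) rfl
  clear IH
  rcases S.eq_empty_or_nonempty with rfl | ⟨v, hv⟩
  · exact ⟨0, by simp⟩
  by_cases hw : ∃ w ∈ S, G.Adj v w ∧ P v w
  · obtain ⟨w, hw, hvw, hPvw⟩ := hw
    have hwv := hvw.ne'
    obtain ⟨f, hf⟩ := IH' ((S.erase v).erase w)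
      ((Finset.erase_subset _ _).trans_ssubset (Finset.erase_ssubset hv))
    obtain ⟨c, hc⟩ := exists_forall_ne
      (X := fun x => x ∈ (S.erase v).erase w ∧ (G.Adj v x ∨ G.Adj w x)) f (by
        intro a b d ha hb hd
        simp only [Finset.mem_erase] at ha hb hd
        have h1 : ∀ x ∈ S, ∀ y ∈ S, x ≠ w → y ≠ w → G.Adj v x → G.Adj v y → x = y := by
          intro x hx y hy hxw hyw hvx hvy
          rcases hG v hv w hw x hx y hy hvw hvx hvy with e | e | e
          exacts [absurd e.symm hxw, e, absurd e.symm hyw]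
        have h2 : ∀ x ∈ S, ∀ y ∈ S, x ≠ v → y ≠ v → G.Adj w x → G.Adj w y → x = y := by
          intro x hx y hy hxw hyw hvx hvy
          rcases hG w hw v hv x hx y hy hvw.symm hvx hvy with e | e | e
          exacts [absurd e.symm hxw, e, absurd e.symm hyw]
        grind)
    have cross : ∀ x ∈ (S.erase v).erase w, G.Adj v x ∨ G.Adj w x → ∀ y, y = v ∨ y = w →
        G.Adj y x → (c = f x ↔ P y x) := by
      intro x hx hadj y hy hyx
      refine iff_of_false (hc x ⟨hx, hadj⟩).symm fun hPyx => ?_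
      simp only [Finset.mem_erase] at hx
      rcases hy with rfl | rfl
      · exact hx.1 (hm _ hv x hx.2.2 w hw hyx hvw hPyx hPvw)
      · exact hx.2.1 (hm _ hw x hx.2.2 v hv hyx hvw.symm hPyx (hP _ _ hPvw))
    refine ⟨fun u => if u = v ∨ u = w then c else f u, fun a ha b hb hab => ?_⟩
    by_cases h1 : a = v ∨ a = w <;> by_cases h2 : b = v ∨ b = w
    · simp only [h1, h2, if_true, true_iff]
      rcases h1 with rfl | rfl <;> rcases h2 with rfl | rfl
      exacts [(hab.ne rfl).elim, hPvw, hP _ _ hPvw, (hab.ne rfl).elim]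
    · simp only [h1, h2, if_true, if_false]
      push Not at h2
      exact cross b (by simp [*]) (by rcases h1 with rfl | rfl <;> simp [hab]) a h1 hab
    · simp only [h1, h2, if_true, if_false]
      push Not at h1
      rw [eq_comm, cross a (by simp [*]) (by rcases h2 with rfl | rfl <;> simp [hab.symm]) b h2
        hab.symm]
      exact ⟨hP _ _, hP _ _⟩
    · simp only [h1, h2, if_false]
      push Not at h1 h2
      exact hf a (by simp [*]) b (by simp [*]) hab
  · push Not at hw
    obtain ⟨f, hf⟩ := IH' (S.erase v) (Finset.erase_ssubset hv)
    obtain ⟨c, hc⟩ := exists_forall_ne (X := fun x => x ∈ S ∧ G.Adj v x) f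
      fun a b d ha hb hd => hG v hv a ha.1 b hb.1 d hd.1 ha.2 hb.2 hd.2
    refine ⟨Function.update f v c, fun a ha b hb hab => ?_⟩
    by_cases h1 : a = v
    · subst h1
      rw [Function.update_self, Function.update_of_ne hab.ne']
      exact iff_of_false (hc b ⟨hb, hab⟩).symm (hw b hb hab)
    by_cases h2 : b = v
    · subst h2
      rw [Function.update_self, Function.update_of_ne hab.ne]
      exact iff_of_false (hc a ⟨ha, hab.symm⟩) fun h => hw a ha hab.symm (hP _ _ h)
    · rw [Function.update_of_ne h1, Function.update_of_ne h2]
      exact hf a (by simp [*]) b (by simp [*]) hab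

/-- Colours `m n` of basis quaternions are compatible with the sign relation `P` (`True` for
commuting). -/
lemma exists_basis_colouring_of_degLeTwoOn {P : V → V → Prop} (hP : ∀ a b, P a b → P b a)
    (hG : DegLeTwoOn G S) : ∃ f : V → Fin 4, ∀ a ∈ S, ∀ b ∈ S, G.Adj a b →
      (f a = 0 ∨ f b = 0 ∨ f a = f b ↔ P a b) := by
  classical
  set S' := S.filter fun v => ∃ w ∈ S, G.Adj v w ∧ ¬P v w with hS'
  have hS : S' ⊆ S := Finset.filter_subset _ _
  obtain ⟨f, hf⟩ := exists_three_colouring (S := S') hP (hG.mono hS) (by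
    intro v hv a ha b hb hva hvb hPa hPb
    obtain ⟨hvS, w, hw, hvw, hPw⟩ := Finset.mem_filter.mp hv
    rcases hG v hvS a (hS ha) b (hS hb) w hw hva hvb hvw with e | e | e
    · exact e
    · exact absurd (e ▸ hPb) hPw
    · exact absurd (e ▸ hPa) hPw)
  refine ⟨fun v => if v ∈ S' then (f v).succ else 0, fun a ha b hb hab => ?_⟩
  by_cases h1 : a ∈ S'
  · by_cases h2 : b ∈ S'
    · simp only [h1, h2, if_true, Fin.succ_ne_zero, false_or, Fin.succ_inj]
      exact hf a h1 b h2 hab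
    · simp only [h2, if_false, true_or, or_true, true_iff]
      by_contra h
      exact h2 (Finset.mem_filter.mpr ⟨hb, a, ha, hab.symm, fun h' => h (hP _ _ h')⟩)
  · simp only [h1, if_false, true_or, true_iff]
    by_contra h
    exact h1 (Finset.mem_filter.mpr ⟨ha, b, hb, hab, h⟩)

lemma exists_basis_colouring {P : V → V → Prop} (hP : ∀ a b, P a b → P b a)
    (hG : DegLeTwoOn G B) (h : PeelsTo G B) {T : Finset V} (hT : B ⊆ T) :
    ∃ f : V → Fin 4, ∀ a ∈ T, ∀ b ∈ T, G.Adj a b → (f a = 0 ∨ f b = 0 ∨ f a = f b ↔ P a b) := by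
  suffices ∃ f : V → Fin 4, (∀ a ∈ T, a ∉ B → f a ≠ 0) ∧ ∀ a ∈ T, ∀ b ∈ T, G.Adj a b →
      (f a = 0 ∨ f b = 0 ∨ f a = f b ↔ P a b) from let ⟨f, hf⟩ := this; ⟨f, hf.2⟩
  refine h.induction (P := fun T => ∃ f : V → Fin 4, (∀ a ∈ T, a ∉ B → f a ≠ 0) ∧
    ∀ a ∈ T, ∀ b ∈ T, G.Adj a b → (f a = 0 ∨ f b = 0 ∨ f a = f b ↔ P a b)) ?_ ?_ hT
  · obtain ⟨f, hf⟩ := exists_basis_colouring_of_degLeTwoOn hP hG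
    exact ⟨f, fun a ha ha' => absurd ha ha', hf⟩
  · rintro T - v hv hvB hvB' hleaf ⟨f, hf1, hf2⟩
    obtain ⟨c, hc0, hc⟩ : ∃ c : Fin 4, c ≠ 0 ∧
        ∀ w ∈ T, G.Adj v w → (c = 0 ∨ f w = 0 ∨ c = f w ↔ P v w) := by
      by_cases hw : ∃ w ∈ T, G.Adj v w
      · obtain ⟨w, hw, hvw⟩ := hw
        have hw0 : f w ≠ 0 := hf1 w (Finset.mem_erase.mpr ⟨hvw.ne', hw⟩) fun h => hvB' w h hvw
        obtain ⟨c, hc0, hc⟩ : ∃ c : Fin 4, c ≠ 0 ∧ (c = f w ↔ P v w) := by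
          by_cases hPv : P v w
          · exact ⟨f w, hw0, by simp [hPv]⟩
          · have : ∀ d : Fin 4, ∃ c : Fin 4, c ≠ 0 ∧ c ≠ d := by decide
            obtain ⟨c, h1, h2⟩ := this (f w)
            exact ⟨c, h1, by simp [hPv, h2]⟩
        refine ⟨c, hc0, fun u hu hvu => ?_⟩
        obtain rfl := hleaf u hu w hw hvu hvw
        simp [hc0, hw0, hc]
      · push Not at hw
        exact ⟨1, by decide, fun w hw' hvw => absurd hvw (hw w hw')⟩
    refine ⟨Function.update f v c, fun a ha haB => ?_, fun a ha b hb hab => ?_⟩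
    · by_cases h1 : a = v
      · subst h1
        simpa using hc0
      · rw [Function.update_of_ne h1]
        exact hf1 a (by simp [*]) haB
    · by_cases h1 : a = v
      · subst h1
        rw [Function.update_self, Function.update_of_ne hab.ne']
        exact hc b hb hab
      by_cases h2 : b = v
      · subst h2
        rw [Function.update_self, Function.update_of_ne hab.ne]
        have := hc a ha hab.symm
        constructor
        · intro h
          exact hP _ _ (this.mp (by tauto))
        · intro h
          have := this.mpr (hP _ _ h)
          tauto
      · rw [Function.update_of_ne h1, Function.update_of_ne h2]
        exact hf2 a (by simp [*]) b (by simp [*]) hab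

end Structure

section Rotation

/-- The rotation matrix of conjugation by a nonzero quaternion. -/
def rotMat (q : ℍ[ℝ]) : Matrix (Fin 3) (Fin 3) ℝ :=
  (Quaternion.normSq q)⁻¹ •
    !![q.re ^ 2 + q.imI ^ 2 - q.imJ ^ 2 - q.imK ^ 2, 2 * (q.imI * q.imJ - q.re * q.imK),
        2 * (q.imI * q.imK + q.re * q.imJ);
      2 * (q.imI * q.imJ + q.re * q.imK), q.re ^ 2 - q.imI ^ 2 + q.imJ ^ 2 - q.imK ^ 2,
        2 * (q.imJ * q.imK - q.re * q.imI);
      2 * (q.imI * q.imK - q.re * q.imJ), 2 * (q.imJ * q.imK + q.re * q.imI),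
        q.re ^ 2 - q.imI ^ 2 - q.imJ ^ 2 + q.imK ^ 2]

@[simp] lemma imQuat_re (v : Fin 3 → ℝ) : (imQuat v).re = 0 := rfl

@[simp] lemma imQuat_imI (v : Fin 3 → ℝ) : (imQuat v).imI = v 0 := rfl

@[simp] lemma imQuat_imJ (v : Fin 3 → ℝ) : (imQuat v).imJ = v 1 := rfl

@[simp] lemma imQuat_imK (v : Fin 3 → ℝ) : (imQuat v).imK = v 2 := rfl

lemma quatLift_rotMat (q : ℍ[ℝ]) : QuatLift q (rotMat q) := by
  intro v
  rw [Quaternion.inv_def, mul_smul_comm, rotMat, Matrix.smul_mulVec]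
  ext <;>
  simp only [imQuat_re, imQuat_imI, imQuat_imJ, imQuat_imK, Matrix.mulVec, dotProduct,
    Fin.sum_univ_three, Quaternion.re_smul, Quaternion.imI_smul, Quaternion.imJ_smul,
    Quaternion.imK_smul, Quaternion.re_mul, Quaternion.imI_mul, Quaternion.imJ_mul,
    Quaternion.imK_mul, Quaternion.re_star, Quaternion.imI_star, Quaternion.imJ_star,
    Quaternion.imK_star, Pi.smul_apply, smul_eq_mul, Matrix.of_apply, Matrix.cons_val',
    Matrix.cons_val_zero, Matrix.cons_val_one, Matrix.cons_val] <;> ring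

lemma rotMat_mem {q : ℍ[ℝ]} (hq : q ≠ 0) :
    rotMat q * (rotMat q).transpose = 1 ∧ (rotMat q).det = 1 := by
  have h : Quaternion.normSq q ≠ 0 := Quaternion.normSq_ne_zero.mpr hq
  have hn := Quaternion.normSq_def' q
  generalize hm : Quaternion.normSq q = n at h hn
  constructor
  · simp only [rotMat, hm, Matrix.transpose_smul, Matrix.smul_mul, Matrix.mul_smul, smul_smul]
    ext i j
    rw [Matrix.smul_apply, Matrix.mul_apply, Fin.sum_univ_three]
    simp only [Matrix.transpose_apply]
    fin_cases i <;> fin_cases j <;> simp [h] <;> field_simp <;> (try rw [hn]) <;> ring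
  · simp only [rotMat, hm, Matrix.det_smul, Fintype.card_fin]
    simp only [Matrix.det_fin_three, Matrix.of_apply, Matrix.cons_val', Matrix.cons_val_zero,
      Matrix.cons_val_one, Matrix.cons_val]
    field_simp
    rw [hn]
    ring

lemma continuousOn_rotMat : ContinuousOn rotMat {q | q ≠ 0} := by
  unfold rotMat
  refine ContinuousOn.smul (ContinuousOn.inv₀ Quaternion.continuous_normSq.continuousOn
    fun q hq => Quaternion.normSq_ne_zero.mpr hq) (Continuous.continuousOn ?_)
  have h0 := Quaternion.continuous_re
  have h1 := Quaternion.continuous_imI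
  have h2 := Quaternion.continuous_imJ
  have h3 := Quaternion.continuous_imK
  refine continuous_matrix fun i j => ?_
  fin_cases i <;> fin_cases j <;> simp <;> fun_prop

lemma trace_rotMat {q : ℍ[ℝ]} (hq : ‖q‖ = 1) : (rotMat q).trace = 4 * q.re ^ 2 - 1 := by
  have h : Quaternion.normSq q = 1 := by rw [Quaternion.normSq_eq_norm_mul_self, hq, one_mul]
  have hn := Quaternion.normSq_def' q
  rw [h] at hn
  simp only [rotMat, h, inv_one, one_smul, Matrix.trace_fin_three, Matrix.of_apply,
    Matrix.cons_val', Matrix.cons_val_zero, Matrix.cons_val_one, Matrix.cons_val]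
  linear_combination hn

lemma imQuat_injective : Function.Injective imQuat := by
  intro v w h
  have h1 := congrArg (·.imI) h
  have h2 := congrArg (·.imJ) h
  have h3 := congrArg (·.imK) h
  funext i
  fin_cases i
  exacts [h1, h2, h3]

variable {q p : ℍ[ℝ]} {A B : Matrix (Fin 3) (Fin 3) ℝ}

lemma QuatLift.unique (hA : QuatLift q A) (hB : QuatLift q B) : A = B := by
  apply Matrix.ext_of_mulVec_single
  intro i
  exact imQuat_injective ((hA _).symm.trans (hB _))

lemma QuatLift.eq_rotMat (hA : QuatLift q A) : A = rotMat q := hA.unique (quatLift_rotMat q)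

lemma QuatLift.mul (hA : QuatLift q A) (hB : QuatLift p B) : QuatLift (q * p) (A * B) := by
  intro v
  rw [← Matrix.mulVec_mulVec, ← hA, ← hB, mul_inv_rev]
  simp only [mul_assoc]

lemma QuatLift.neg (hA : QuatLift q A) : QuatLift (-q) A := by
  intro v
  rw [← hA v]
  simp

lemma rotMat_neg (q : ℍ[ℝ]) : rotMat (-q) = rotMat q := (quatLift_rotMat q).neg.eq_rotMat.symm

lemma SignCommute.rotMat_commute (h : SignCommute q p) :
    rotMat q * rotMat p = rotMat p * rotMat q := by
  have h1 := ((quatLift_rotMat q).mul (quatLift_rotMat p))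
  have h2 := ((quatLift_rotMat p).mul (quatLift_rotMat q))
  rcases h with h | h
  · rw [h] at h1
    exact h1.unique h2
  · rw [h] at h1
    exact h1.unique h2.neg

lemma eq_coe_of_commute_imQuat {u : ℍ[ℝ]} (h : ∀ v, u * imQuat v = imQuat v * u) :
    u = (u.re : ℍ[ℝ]) := by
  have h1 := congrArg (·.imK) (h ![1, 0, 0])
  have h2 := congrArg (·.imJ) (h ![1, 0, 0])
  have h3 := congrArg (·.imK) (h ![0, 1, 0])
  simp [Quaternion.imK_mul, Quaternion.imJ_mul] at h1 h2 h3
  ext <;> simp <;> linarith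

lemma QuatLift.eq_or_eq_neg (hq : QuatLift q A) (hp : QuatLift p A) (hq1 : ‖q‖ = 1)
    (hp1 : ‖p‖ = 1) : q = p ∨ q = -p := by
  have hq0 : q ≠ 0 := by rintro rfl; simp at hq1
  have hp0 : p ≠ 0 := by rintro rfl; simp at hp1
  have h := eq_coe_of_commute_imQuat (u := p⁻¹ * q) fun v => by
    have := (hq v).trans (hp v).symm
    rw [mul_inv_eq_iff_eq_mul₀ hq0] at this
    rw [mul_assoc, this]
    simp [mul_assoc, hp0]
  have hn : ‖p⁻¹ * q‖ = 1 := by rw [norm_mul, norm_inv, hq1, hp1]; simp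
  rw [h, Quaternion.norm_coe, Real.norm_eq_abs] at hn
  rw [inv_mul_eq_iff_eq_mul₀ hp0] at h
  rcases eq_or_eq_neg_of_abs_eq hn with e | e <;> rw [e] at h
  · exact Or.inl (by simpa using h)
  · exact Or.inr (by simpa using h)

lemma QuatLift.signCommute (hq : QuatLift q A) (hp : QuatLift p B) (hq1 : ‖q‖ = 1)
    (hp1 : ‖p‖ = 1) (h : A * B = B * A) : SignCommute q p :=
  (hq.mul hp).eq_or_eq_neg (by rw [h]; exact hp.mul hq) (by simp [hq1, hp1]) (by simp [hq1, hp1])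

lemma QuatLift.smul {r : ℝ} (hr : r ≠ 0) (hq : QuatLift q A) : QuatLift (r • q) A := by
  intro v
  rw [← hq v, smul_inv₀, smul_mul_assoc, smul_mul_smul_comm, mul_inv_cancel₀ hr, one_smul]

/-- Every rotation lifts to a unit quaternion. -/
lemma exists_quatLift (hA : A * A.transpose = 1) (hdet : A.det = 1) :
    ∃ q, ‖q‖ = 1 ∧ QuatLift q A := by
  suffices ∃ q, q ≠ 0 ∧ QuatLift q A by
    obtain ⟨q, hq0, hq⟩ := this
    have h0 : ‖q‖ ≠ 0 := norm_ne_zero_iff.mpr hq0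
    exact ⟨‖q‖⁻¹ • q, by simp [norm_smul, h0], hq.smul (inv_ne_zero h0)⟩
  have hA' : A.transpose * A = 1 := mul_eq_one_comm.mp hA
  have hadj : A.adjugate = A.transpose := by
    have h1 : A * A.adjugate = 1 := by rw [Matrix.mul_adjugate, hdet, one_smul]
    calc A.adjugate = A.transpose * A * A.adjugate := by rw [hA', one_mul]
      _ = A.transpose := by rw [mul_assoc, h1, mul_one]
  have col : ∀ i j, A 0 i * A 0 j + A 1 i * A 1 j + A 2 i * A 2 j = if i = j then 1 else 0 := by
    intro i j
    have := congrFun (congrFun hA' i) j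
    rwa [Matrix.mul_apply, Fin.sum_univ_three, Matrix.one_apply] at this
  set f : Fin 3 → ℍ[ℝ] := fun j => imQuat fun i => A i j with hf
  have sq : ∀ j, f j * f j = -1 := fun j => by
    rw [sq_eq_neg_one_iff]
    refine ⟨rfl, ?_⟩
    have := col j j
    rw [if_pos rfl] at this
    simp only [hf, imQuat_imI, imQuat_imJ, imQuat_imK]
    linarith
  have h01 : f 0 * f 1 = f 2 := by
    have c01 := col 0 1
    rw [if_neg (by decide)] at c01
    rw [Matrix.adjugate_fin_three] at hadj
    have a0 := congrFun (congrFun hadj 2) 0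
    have a1 := congrFun (congrFun hadj 2) 1
    have a2 := congrFun (congrFun hadj 2) 2
    simp only [Matrix.transpose_apply, Matrix.of_apply, Matrix.cons_val', Matrix.cons_val_zero,
      Matrix.cons_val_one, Matrix.cons_val] at a0 a1 a2
    ext <;> simp only [hf, Quaternion.re_mul, Quaternion.imI_mul, Quaternion.imJ_mul,
      Quaternion.imK_mul, imQuat_re, imQuat_imI, imQuat_imJ, imQuat_imK] <;> linarith
  have h010 : f 1 * f 0 * f 1 = f 0 := by
    have : f 0 * (f 1 * f 0 * f 1) = f 0 * f 0 := by
      rw [sq 0, ← sq 2, ← h01]; simp only [mul_assoc]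
    refine mul_left_cancel₀ (fun h => ?_) this
    have := sq 0
    simp [h] at this
  have h10 : f 1 * f 0 = -f 2 := by
    have := congrArg (· * f 1) h010
    rw [h01, mul_assoc, sq 1] at this
    rw [← this]
    simp
  have h02 : f 0 * f 2 = -f 1 := by rw [← h01, ← mul_assoc, sq]; simp
  have h12 : f 1 * f 2 = f 0 := by rw [← h01, ← mul_assoc, h010]
  have h20 : f 2 * f 0 = f 1 := by rw [← h01, mul_assoc, h10, mul_neg, h02, neg_neg]
  have h21 : f 2 * f 1 = -f 0 := by rw [← h01, mul_assoc, sq]; simp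
  set e : Fin 3 → ℍ[ℝ] := fun n => basisQuat n.succ with he
  have esq : ∀ n, e n * e n = -1 := fun n => basisQuat_sq (Fin.succ_ne_zero n)
  have e01 : e 0 * e 1 = e 2 := by
    ext <;> simp only [Quaternion.re_mul, Quaternion.imI_mul, Quaternion.imJ_mul,
      Quaternion.imK_mul] <;> simp [he, basisQuat]
  have e10 : e 1 * e 0 = -e 2 := by
    rw [basisQuat_anticommute (by decide) (by decide) (by decide)]
    exact congrArg _ e01
  have e02 : e 0 * e 2 = -e 1 := by rw [← e01, ← mul_assoc, esq]; simp
  have e20 : e 2 * e 0 = e 1 := by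
    rw [basisQuat_anticommute (by decide) (by decide) (by decide)]
    exact neg_eq_iff_eq_neg.mpr e02
  have e12 : e 1 * e 2 = e 0 := by
    ext <;> simp only [Quaternion.re_mul, Quaternion.imI_mul, Quaternion.imJ_mul,
      Quaternion.imK_mul] <;> simp [he, basisQuat]
  have e21 : e 2 * e 1 = -e 0 := by rw [← e01, mul_assoc, esq]; simp
  set Q : ℍ[ℝ] → ℍ[ℝ] := fun c => c - f 0 * c * e 0 - f 1 * c * e 1 - f 2 * c * e 2 with hQ
  have lift : ∀ c, Q c ≠ 0 → QuatLift (Q c) A := by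
    intro c hc v
    have k0 : Q c * e 0 = f 0 * Q c := by
      simp only [hQ, sub_mul, mul_sub, mul_assoc, esq, e10, e20]
      simp only [← mul_assoc, sq, h01, h02]
      simp only [mul_neg, neg_mul, mul_one, one_mul]
      abel
    have k1 : Q c * e 1 = f 1 * Q c := by
      simp only [hQ, sub_mul, mul_sub, mul_assoc, esq, e01, e21]
      simp only [← mul_assoc, sq, h10, h12]
      simp only [mul_neg, neg_mul, mul_one, one_mul]
      abel
    have k2 : Q c * e 2 = f 2 * Q c := by
      simp only [hQ, sub_mul, mul_sub, mul_assoc, esq, e02, e12]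
      simp only [← mul_assoc, sq, h20, h21]
      simp only [mul_neg, neg_mul, mul_one, one_mul]
      abel
    have v1 : imQuat v = v 0 • e 0 + v 1 • e 1 + v 2 • e 2 := by
      ext <;> simp only [Quaternion.re_add, Quaternion.imI_add, Quaternion.imJ_add,
        Quaternion.imK_add, Quaternion.re_smul, Quaternion.imI_smul, Quaternion.imJ_smul,
        Quaternion.imK_smul] <;> simp [he, basisQuat]
    have v2 : imQuat (A.mulVec v) = v 0 • f 0 + v 1 • f 1 + v 2 • f 2 := by
      ext <;> simp [hf, Matrix.mulVec, dotProduct, Fin.sum_univ_three] <;> ring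
    rw [mul_inv_eq_iff_eq_mul₀ hc, v1, v2]
    simp only [mul_add, add_mul, mul_smul_comm, smul_mul_assoc, k0, k1, k2]
  by_contra! hno
  have z : ∀ c, Q c = 0 := fun c => by
    by_contra h
    exact hno _ h (lift c h)
  have : Q 1 - Q (e 0) * e 0 - Q (e 1) * e 1 - Q (e 2) * e 2 = 1 + 1 + 1 + 1 := by
    simp only [hQ, sub_mul, mul_assoc, esq, e01, e10, e02, e20, e12, e21, mul_neg, neg_mul,
      mul_one, one_mul]
    abel
  simp only [z, zero_mul, sub_zero] at this
  have hre := congrArg (·.re) this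
  simp only [Quaternion.re_add, Quaternion.re_zero, Quaternion.re_one] at hre
  norm_num at hre

end Rotation

section Components

lemma quaternion_re_mul_comm (a b : ℍ[ℝ]) : (a * b).re = (b * a).re := by
  simp only [Quaternion.re_mul]
  ring

lemma re_eq_zero_of_anticommute {a b : ℍ[ℝ]} (hb : b ≠ 0) (h : a * b = -(b * a)) : a.re = 0 := by
  have h1 : (b⁻¹ * (b * a)).re = -(b⁻¹ * (b * a)).re := by
    rw [← Quaternion.re_neg, ← mul_neg, ← h, ← mul_assoc, inv_mul_cancel₀ hb, one_mul,
      quaternion_re_mul_comm, mul_assoc, mul_inv_cancel₀ hb, mul_one]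
  rw [← mul_assoc, inv_mul_cancel₀ hb, one_mul] at h1
  linarith

lemma normSq_eq_one_of_norm {q : ℍ[ℝ]} (hq : ‖q‖ = 1) :
    q.re ^ 2 + q.imI ^ 2 + q.imJ ^ 2 + q.imK ^ 2 = 1 := by
  rw [← Quaternion.normSq_def', Quaternion.normSq_eq_norm_mul_self, hq, one_mul]

lemma sq_eq_neg_one_of_re_eq_zero {q : ℍ[ℝ]} (hq : ‖q‖ = 1) (h : q.re = 0) : q * q = -1 := by
  have := normSq_eq_one_of_norm hq
  rw [h] at this
  exact sq_eq_neg_one_iff.mpr ⟨h, by linarith⟩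

variable {V : Type*} {K : SimpleGraph V}

/-- Families of nonzero quaternions that commute up to sign along the edges of `K`. -/
def liftSet (K : SimpleGraph V) : Set (V → ℍ[ℝ]) :=
  {q | (∀ v, q v ≠ 0) ∧ ∀ a b, K.Adj a b → SignCommute (q a) (q b)}

/-- The point of the representation variety covered by a family of quaternions. -/
def toRepVar (K : SimpleGraph V) (q : liftSet K) : RepVar K :=
  ⟨fun v => ⟨rotMat (q.1 v), rotMat_mem (q.2.1 v)⟩, fun v w h => (q.2.2 v w h).rotMat_commute⟩

lemma continuous_toRepVar : Continuous (toRepVar K) := by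
  refine Continuous.subtype_mk (continuous_pi fun v => Continuous.subtype_mk ?_ _) _
  exact continuousOn_rotMat.comp_continuous
    ((continuous_apply v).comp continuous_subtype_val) fun q => q.2.1 v

lemma toRepVar_eq_of_joinedIn {q p : V → ℍ[ℝ]} (h : JoinedIn (liftSet K) q p) :
    (toRepVar K ⟨q, h.source_mem⟩ : ConnectedComponents (RepVar K)) =
      toRepVar K ⟨p, h.target_mem⟩ := by
  rw [ConnectedComponents.coe_eq_coe']
  exact pathComponent_subset_component _ (h.joined_subtype.map continuous_toRepVar).symm

lemma exists_realOrPure_joinedIn [Fintype V] {q : V → ℍ[ℝ]} (hq : q ∈ liftSet K)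
    (h1 : ∀ v, ‖q v‖ = 1) :
    ∃ p, RealOrPureOn Finset.univ p ∧ JoinedIn (liftSet K) q p := by
  classical
  set f : ℝ → V → ℍ[ℝ] := fun t v => (if (q v).re = 0 then 1 else 1 - t) • q v +
    ((if (q v).re = 0 then 0 else t * ((q v).re / |(q v).re|) : ℝ) : ℍ[ℝ]) with hf
  have f0 : ∀ t v, (q v).re = 0 → f t v = q v := fun t v h => by simp [hf, h]
  have hfc : ContinuousOn f unitInterval := by
    refine Continuous.continuousOn (continuous_pi fun v => ?_)
    simp only [hf]
    split_ifs with h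
    · fun_prop
    · exact ((continuous_const.sub continuous_id).smul continuous_const).add
        (Quaternion.continuous_coe.comp (continuous_id.mul continuous_const))
  refine ⟨f 1, fun v _ => ?_, JoinedIn.ofLine hfc ?_ rfl ?_⟩
  · by_cases h : (q v).re = 0
    · rw [f0 1 v h]
      exact Or.inr (sq_eq_neg_one_of_re_eq_zero (h1 v) h)
    · left
      have h2 : (q v).re / |(q v).re| * ((q v).re / |(q v).re|) = 1 := by
        rw [div_mul_div_comm, abs_mul_abs_self, div_self (mul_ne_zero h h)]
      simp only [hf, h, if_false, sub_self, zero_smul, one_mul, zero_add]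
      rw [← Quaternion.coe_mul, h2, Quaternion.coe_one]
  · funext v
    simp only [hf]
    split_ifs <;> simp
  · rintro _ ⟨t, ⟨ht0, ht1⟩, rfl⟩
    refine ⟨fun v => ?_, fun a b hab => ?_⟩
    · by_cases h : (q v).re = 0
      · rw [f0 t v h]
        exact hq.1 v
      · intro h0
        have hre := congrArg (·.re) h0
        simp only [hf, h, if_false, Quaternion.re_add, Quaternion.re_smul, Quaternion.re_coe,
          Quaternion.re_zero, smul_eq_mul] at hre
        have hpos : 0 < |(q v).re| := abs_pos.mpr h
        have h3 : (q v).re * ((1 - t) * |(q v).re| + t) = 0 := by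
          field_simp at hre
          linear_combination hre
        have h4 : (1 - t) * |(q v).re| + t = 0 := (mul_eq_zero.mp h3).resolve_left h
        have h5 : 0 ≤ (1 - t) * |(q v).re| := mul_nonneg (by linarith) hpos.le
        have h6 : t = 0 := by linarith
        rw [h6] at h4
        linarith
    · rcases hq.2 a b hab with h | h
      · left
        have hc : Commute (q a) (q b) := h
        refine Commute.add_left (Commute.add_right ?_ ?_) (Commute.add_right ?_ ?_)
        · exact (hc.smul_left _).smul_right _
        · exact (Quaternion.coe_commute _ _).symm
        · exact Quaternion.coe_commute _ _
        · exact Quaternion.coe_commute _ _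
      · have ha := re_eq_zero_of_anticommute (hq.1 b) h
        have hb := re_eq_zero_of_anticommute (hq.1 a) (by rw [h, neg_neg] : q b * q a = -(q a * q b))
        rw [f0 t a ha, f0 t b hb]
        exact hq.2 a b hab

lemma JoinedIn.conjFun_liftSet [Fintype V] {q R : V → ℍ[ℝ]} (hq : ∀ v, q v ≠ 0)
    (h : JoinedIn (conjugators K Finset.univ q) 1 R) : JoinedIn (liftSet K) q (conjFun R q) := by
  have hc : ContinuousOn (fun R => conjFun R q) (conjugators K Finset.univ q) := by
    refine continuousOn_pi.mpr fun v => ?_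
    have hv : ContinuousOn (fun R : V → ℍ[ℝ] => R v) (conjugators K Finset.univ q) :=
      (continuous_apply v).continuousOn
    exact (hv.mul continuousOn_const).mul (hv.inv₀ fun R hR => hR.1 v)
  have h2 := (h.map_continuousOn hc).mono (V := liftSet K) (by
    rintro _ ⟨R, hR, rfl⟩
    refine ⟨fun v => ?_, fun a b hab => hR.2 a (Finset.mem_univ a) b (Finset.mem_univ b) hab⟩
    exact mul_ne_zero (mul_ne_zero (hR.1 v) (hq v)) (inv_ne_zero (hR.1 v)))
  have h1 : conjFun 1 q = q := by funext v; simp [conjFun]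
  rwa [h1] at h2

lemma exists_toRepVar_eq (x : RepVar K) : ∃ q : liftSet K, (∀ v, ‖q.1 v‖ = 1) ∧
    x = toRepVar K q := by
  choose q hq1 hq using fun v => exists_quatLift (x.1 v).2.1 (x.1 v).2.2
  refine ⟨⟨q, fun v h => ?_, fun a b hab =>
    (hq a).signCommute (hq b) (hq1 a) (hq1 b) (x.2 a b hab)⟩, hq1, ?_⟩
  · have := hq1 v
    rw [h] at this
    simp at this
  · exact Subtype.ext (funext fun v => Subtype.ext (hq v).eq_rotMat)

lemma basisQuat_norm (n : Fin 4) : ‖basisQuat n‖ = 1 := by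
  by_cases h : n = 0
  · have h1 : basisQuat 0 = 1 := by ext <;> simp [basisQuat]
    rw [h, h1, norm_one]
  · exact norm_eq_one_of_sq_eq_neg_one (basisQuat_sq h)

lemma basisQuat_comp_mem_liftSet (K : SimpleGraph V) (f : V → Fin 4) :
    (fun v => basisQuat (f v)) ∈ liftSet K := by
  refine ⟨fun v h => ?_, fun a b _ => ?_⟩
  · have := basisQuat_norm (f v)
    rw [show basisQuat (f v) = 0 from h] at this
    simp at this
  · by_cases h : f a = 0 ∨ f b = 0 ∨ f a = f b
    · exact Or.inl (basisQuat_commute h)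
    · push Not at h
      exact Or.inr (basisQuat_anticommute h.1 h.2.1 h.2.2)

/-- The representation with values in `{1, diag(1,-1,-1), diag(-1,1,-1), diag(-1,-1,1)}`
prescribed by a colouring of the vertices. -/
def basisRep (K : SimpleGraph V) (f : V → Fin 4) : RepVar K :=
  toRepVar K ⟨_, basisQuat_comp_mem_liftSet K f⟩

lemma toRepVar_eq_basisRep {q : V → ℍ[ℝ]} (hq : q ∈ liftSet K) {f : V → Fin 4}
    (hf : ∀ v, q v = basisQuat (f v) ∨ q v = -basisQuat (f v)) :
    toRepVar K ⟨q, hq⟩ = basisRep K f := by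
  refine Subtype.ext (funext fun v => Subtype.ext ?_)
  change rotMat (q v) = rotMat (basisQuat (f v))
  rcases hf v with h | h <;> rw [h]
  rw [rotMat_neg]

lemma exists_basisRep_component_eq [Fintype V] {B : Finset V} (hB : DegLeTwoOn K B)
    (hp : PeelsTo K B) (x : RepVar K) :
    ∃ f, (basisRep K f : ConnectedComponents (RepVar K)) = x := by
  classical
  obtain ⟨⟨q, hq⟩, hq1, rfl⟩ := exists_toRepVar_eq x
  obtain ⟨p, hp1, hj⟩ := exists_realOrPure_joinedIn hq hq1
  obtain ⟨R, hR, hmem⟩ := alignable_of_peelsTo hB hp (Finset.subset_univ B)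
    (fun a _ b _ hab => hj.target_mem.2 a b hab) hp1
  have hj' := hj.trans (hR.conjFun_liftSet hj.target_mem.1)
  choose f hf using fun v => hmem v (Finset.mem_univ v)
  refine ⟨f, ?_⟩
  rw [toRepVar_eq_of_joinedIn hj', toRepVar_eq_basisRep hj'.target_mem hf]

lemma finite_connectedComponents [Fintype V] {B : Finset V} (hB : DegLeTwoOn K B)
    (hp : PeelsTo K B) : Finite (ConnectedComponents (RepVar K)) := by
  refine Finite.of_surjective
    (fun f : V → Fin 4 => (basisRep K f : ConnectedComponents (RepVar K))) fun c => ?_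
  obtain ⟨x, rfl⟩ := ConnectedComponents.surjective_coe c
  exact exists_basisRep_component_eq hB hp x

/-- For every edge marking there is a representation with this obstruction. -/
lemma exists_isObstruction [Fintype V] {B : Finset V} (hB : DegLeTwoOn K B) (hp : PeelsTo K B)
    (Λ : Sym2 V → ℤˣ) : ∃ x : V → SO3, x ∈ RepVar K ∧ IsObstruction K x Λ := by
  classical
  obtain ⟨f, hf⟩ := exists_basis_colouring (P := fun a b => Λ s(a, b) = 1)
    (fun a b h => by rwa [Sym2.eq_swap]) hB hp (Finset.subset_univ B)
  refine ⟨_, (basisRep K f).2, fun v w hvw =>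
    ⟨basisQuat (f v), basisQuat (f w), basisQuat_norm _, basisQuat_norm _, quatLift_rotMat _,
      quatLift_rotMat _, ?_⟩⟩
  have hv := (basisQuat_comp_mem_liftSet K f).1 v
  have hw := (basisQuat_comp_mem_liftSet K f).1 w
  have hP := hf v (Finset.mem_univ v) w (Finset.mem_univ w) hvw
  rcases Int.units_eq_one_or (Λ s(v, w)) with h | h
  · rw [h, basisQuat_commute (hP.mpr h), mul_inv_cancel_right₀ hv, mul_inv_cancel₀ hw]
    simp
  · have hn : ¬(f v = 0 ∨ f w = 0 ∨ f v = f w) := by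
      rw [hP, h]
      decide
    push Not at hn
    rw [h, basisQuat_anticommute hn.1 hn.2.1 hn.2.2, neg_mul, neg_mul, mul_inv_cancel_right₀ hv,
      mul_inv_cancel₀ hw]
    simp

/-- A sum of traces which detects the obstruction along an edge. -/
def edgeTrace (v w : V) (x : V → SO3) : ℝ :=
  (x v).1.trace + (x w).1.trace + ((x v).1 * (x w).1).trace

lemma continuous_edgeTrace (v w : V) : Continuous (edgeTrace v w) := by
  unfold edgeTrace
  have h : ∀ u : V, Continuous fun x : V → SO3 => (x u).1 := fun u =>
    continuous_subtype_val.comp (continuous_apply u)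
  exact ((h v).matrix_trace.add (h w).matrix_trace).add ((h v).matrix_mul (h w)).matrix_trace

lemma edgeTrace_eq {v w : V} {x : V → SO3} {q p : ℍ[ℝ]} (hq1 : ‖q‖ = 1) (hp1 : ‖p‖ = 1)
    (hq : QuatLift q (x v).1) (hp : QuatLift p (x w).1) :
    edgeTrace v w x = 4 * (q.re ^ 2 + p.re ^ 2 + (q * p).re ^ 2) - 3 := by
  rw [edgeTrace, (hq.mul hp).eq_rotMat, hq.eq_rotMat, hp.eq_rotMat, trace_rotMat hq1,
    trace_rotMat hp1, trace_rotMat (by rw [norm_mul, hq1, hp1, one_mul])]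
  ring

lemma half_le_of_commute {q p : ℍ[ℝ]} (hq1 : ‖q‖ = 1) (hp1 : ‖p‖ = 1) (h : q * p = p * q) :
    1 / 2 ≤ q.re ^ 2 + p.re ^ 2 + (q * p).re ^ 2 := by
  have hq := normSq_eq_one_of_norm hq1
  have hp := normSq_eq_one_of_norm hp1
  have hi := congrArg (·.imI) h
  have hj := congrArg (·.imJ) h
  have hk := congrArg (·.imK) h
  simp only [Quaternion.imI_mul, Quaternion.imJ_mul, Quaternion.imK_mul] at hi hj hk
  have ei : q.imJ * p.imK - q.imK * p.imJ = 0 := by linarith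
  have ej : q.imK * p.imI - q.imI * p.imK = 0 := by linarith
  have ek : q.imI * p.imJ - q.imJ * p.imI = 0 := by linarith
  set d := q.imI * p.imI + q.imJ * p.imJ + q.imK * p.imK with hd
  have hdd : d ^ 2 = (1 - q.re ^ 2) * (1 - p.re ^ 2) := by
    have e1 : 1 - q.re ^ 2 = q.imI ^ 2 + q.imJ ^ 2 + q.imK ^ 2 := by linarith
    have e2 : 1 - p.re ^ 2 = p.imI ^ 2 + p.imJ ^ 2 + p.imK ^ 2 := by linarith
    rw [e1, e2, hd]
    linear_combination -(q.imJ * p.imK - q.imK * p.imJ) * ei -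
      (q.imK * p.imI - q.imI * p.imK) * ej - (q.imI * p.imJ - q.imJ * p.imI) * ek
  have hc : (q * p).re = q.re * p.re - d := by
    rw [Quaternion.re_mul, hd]
    ring
  set c := (q * p).re
  have hid : q.re ^ 2 + p.re ^ 2 + c ^ 2 = 1 + 2 * (q.re * p.re * c) := by
    have : d = q.re * p.re - c := by linarith
    rw [this] at hdd
    linear_combination hdd
  have hb : p.re ^ 2 ≤ 1 := by nlinarith [sq_nonneg p.imI, sq_nonneg p.imJ, sq_nonneg p.imK]
  have hab : q.re ^ 2 * p.re ^ 2 ≤ q.re ^ 2 := mul_le_of_le_one_right (sq_nonneg _) hb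
  nlinarith [sq_nonneg (q.re * p.re + c), sq_nonneg p.re]

variable {v w : V} {x : V → SO3}

lemma edgeTrace_of_commute {q p : ℍ[ℝ]} (hq1 : ‖q‖ = 1) (hp1 : ‖p‖ = 1)
    (hq : QuatLift q (x v).1) (hp : QuatLift p (x w).1) (h : q * p = p * q) :
    -1 ≤ edgeTrace v w x := by
  rw [edgeTrace_eq hq1 hp1 hq hp]
  linarith [half_le_of_commute hq1 hp1 h]

lemma edgeTrace_of_anticommute {q p : ℍ[ℝ]} (hq1 : ‖q‖ = 1) (hp1 : ‖p‖ = 1)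
    (hq : QuatLift q (x v).1) (hp : QuatLift p (x w).1) (h : q * p = -(p * q)) :
    edgeTrace v w x = -3 := by
  have hq0 : q ≠ 0 := by rintro rfl; simp at hq1
  have hp0 : p ≠ 0 := by rintro rfl; simp at hp1
  have h1 := re_eq_zero_of_anticommute hp0 h
  have h2 := re_eq_zero_of_anticommute hq0 (by rw [h, neg_neg] : p * q = -(q * p))
  have h3 : (q * p).re = 0 := by
    have := congrArg (·.re) h
    simp only [Quaternion.re_neg, quaternion_re_mul_comm p q] at this
    linarith
  rw [edgeTrace_eq hq1 hp1 hq hp, h1, h2, h3]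
  norm_num

lemma isClopen_edgeTrace_lt (h : K.Adj v w) :
    IsClopen {x : RepVar K | edgeTrace v w x.1 < -2} := by
  have hc : Continuous fun x : RepVar K => edgeTrace v w x.1 :=
    (continuous_edgeTrace v w).comp continuous_subtype_val
  refine ⟨?_, isOpen_lt hc continuous_const⟩
  have : {x : RepVar K | edgeTrace v w x.1 < -2} = {x : RepVar K | edgeTrace v w x.1 ≤ -3} := by
    ext x
    simp only [Set.mem_ofPred_eq]
    obtain ⟨q, hq1, hq⟩ := exists_quatLift (x.1 v).2.1 (x.1 v).2.2
    obtain ⟨p, hp1, hp⟩ := exists_quatLift (x.1 w).2.1 (x.1 w).2.2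
    rcases hq.signCommute hp hq1 hp1 (x.2 v w h) with e | e
    · have := edgeTrace_of_commute hq1 hp1 hq hp e
      constructor <;> intro <;> linarith
    · have := edgeTrace_of_anticommute hq1 hp1 hq hp e
      constructor <;> intro <;> linarith
  rw [this]
  exact isClosed_le hc continuous_const

lemma IsObstruction.edgeTrace_lt_iff {Λ : Sym2 V → ℤˣ} (hx : IsObstruction K x Λ)
    (h : K.Adj v w) : edgeTrace v w x < -2 ↔ Λ s(v, w) = -1 := by
  obtain ⟨q, p, hq1, hp1, hq, hp, hqp⟩ := hx v w h
  have hq0 : q ≠ 0 := by rintro rfl; simp at hq1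
  have hp0 : p ≠ 0 := by rintro rfl; simp at hp1
  rw [mul_inv_eq_iff_eq_mul₀ hp0, mul_inv_eq_iff_eq_mul₀ hq0] at hqp
  rcases Int.units_eq_one_or (Λ s(v, w)) with e | e <;> rw [e] at hqp ⊢
  · have := edgeTrace_of_commute hq1 hp1 hq hp (by simpa using hqp)
    exact iff_of_false (by linarith) (by decide)
  · have := edgeTrace_of_anticommute hq1 hp1 hq hp (by simpa using hqp)
    exact iff_of_true (by linarith) rfl

lemma IsObstruction.eq_neg_one_of_component_eq {Λ Λ' : Sym2 V → ℤˣ} {x y : RepVar K}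
    (hx : IsObstruction K x.1 Λ) (hy : IsObstruction K y.1 Λ')
    (hxy : (x : ConnectedComponents (RepVar K)) = y) (h : K.Adj v w) (hΛ : Λ s(v, w) = -1) :
    Λ' s(v, w) = -1 := by
  rw [← hy.edgeTrace_lt_iff h]
  exact (isClopen_edgeTrace_lt h).connectedComponent_subset ((hx.edgeTrace_lt_iff h).mpr hΛ)
    (ConnectedComponents.coe_eq_coe'.mp hxy.symm)

lemma two_pow_le_card_connectedComponents [Finite V]
    [Finite (ConnectedComponents (RepVar K))]
    (hsurj : ∀ Λ : Sym2 V → ℤˣ, ∃ x : V → SO3, x ∈ RepVar K ∧ IsObstruction K x Λ) :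
    2 ^ Nat.card K.edgeSet ≤ Nat.card (ConnectedComponents (RepVar K)) := by
  classical
  set ext : (K.edgeSet → ℤˣ) → Sym2 V → ℤˣ := fun Λ e => if h : e ∈ K.edgeSet then Λ ⟨e, h⟩ else 1
    with hext
  choose x hx hob using fun Λ => hsurj (ext Λ)
  have hcard : Nat.card (K.edgeSet → ℤˣ) = 2 ^ Nat.card K.edgeSet := by
    rw [Nat.card_fun]
    simp
  rw [← hcard]
  refine Nat.card_le_card_of_injective
    (fun Λ => ((⟨x Λ, hx Λ⟩ : RepVar K) : ConnectedComponents (RepVar K))) fun Λ Λ' h => ?_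
  funext ⟨e, he⟩
  induction e with | _ v w
  have hadj : K.Adj v w := he
  have e1 : ∀ Λ, ext Λ s(v, w) = Λ ⟨s(v, w), he⟩ := fun Λ => dif_pos he
  have h1 := (hob Λ).eq_neg_one_of_component_eq (x := ⟨x Λ, hx Λ⟩) (y := ⟨x Λ', hx Λ'⟩)
    (hob Λ') h hadj
  have h2 := (hob Λ').eq_neg_one_of_component_eq (x := ⟨x Λ', hx Λ'⟩) (y := ⟨x Λ, hx Λ⟩)
    (hob Λ) h.symm hadj
  rw [e1, e1] at h1 h2
  rcases Int.units_eq_one_or (Λ ⟨s(v, w), he⟩) with e | e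
  · rcases Int.units_eq_one_or (Λ' ⟨s(v, w), he⟩) with e' | e'
    · rw [e, e']
    · rw [h2 e', e']
  · rw [h1 e, e]

end Components

end Auxiliary

theorem obstruction_surjective
    {V : Type} [Fintype V] (K : SimpleGraph V)
    (hK : ∀ c : K.ConnectedComponent,
      (K.induce c.supp).IsTree ∨
      (∃ n : ℕ, 3 ≤ n ∧ Nonempty (K.induce c.supp ≃g SimpleGraph.cycleGraph n))) :
    (∀ Λ : Sym2 V → ℤˣ, ∃ x : V → SO3, x ∈ RepVar K ∧ IsObstruction K x Λ) ∧
    2 ^ Nat.card K.edgeSet ≤ Nat.card (ConnectedComponents (RepVar K)) := by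
  obtain ⟨B, hB, hp⟩ := exists_degLeTwoOn_peelsTo K hK
  have := finite_connectedComponents hB hp
  have h := exists_isObstruction hB hp
  exact ⟨h, two_pow_le_card_connectedComponents h⟩

end
end

section
/- Let K be a finite simple graph such that the obstruction map o_K : R(K, SO(3)) → {±1}^E is surjective. If K₀ is a connected component of K that is not a cycle graph, then K₀ contains no 3-cycle (no triangle). -/
noncomputable section

theorem QuatLift.eq_smul {q p : Quaternion ℝ} {x : Matrix (Fin 3) (Fin 3) ℝ}
    (hq : QuatLift q x) (hp : QuatLift p x) (hq0 : q ≠ 0) (hp0 : p ≠ 0) :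
    ∃ r : ℝ, r ≠ 0 ∧ q = r • p := by
  have comm (v : Fin 3 → ℝ) : (p⁻¹ * q) * imQuat v = imQuat v * (p⁻¹ * q) := by
    have h : q * imQuat v * q⁻¹ = p * imQuat v * p⁻¹ := (hq v).trans (hp v).symm
    calc (p⁻¹ * q) * imQuat v = p⁻¹ * (q * imQuat v * q⁻¹) * q := by
          simp [mul_assoc, inv_mul_cancel₀ hq0]
      _ = p⁻¹ * (p * imQuat v * p⁻¹) * q := by rw [h]
      _ = imQuat v * (p⁻¹ * q) := by simp [← mul_assoc, inv_mul_cancel₀ hp0]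
  have hqp : q = p * (p⁻¹ * q) := by simp [← mul_assoc, mul_inv_cancel₀ hp0]
  generalize p⁻¹ * q = c at comm hqp
  have h1 := comm ![1, 0, 0]
  have h2 := comm ![0, 1, 0]
  simp only [Quaternion.ext_iff, Quaternion.re_mul, Quaternion.imI_mul, Quaternion.imJ_mul,
    Quaternion.imK_mul] at h1 h2
  simp only [imQuat, Matrix.cons_val] at h1 h2
  have hc : c = (c.re : Quaternion ℝ) := by
    ext <;> simp <;> linarith [h1.2.2.1, h1.2.2.2, h2.2.1, h2.2.2.2]
  refine ⟨c.re, fun h0 => hq0 ?_, ?_⟩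
  · rw [hqp, hc, h0]; simp
  · rw [← Quaternion.mul_coe_eq_smul, ← hc, ← hqp]

theorem Quaternion.re_eq_zero_of_anticomm {b d : Quaternion ℝ} (hb : b ≠ 0)
    (h : b * d = -(d * b)) : d.re = 0 := by
  have hn : Quaternion.normSq b ≠ 0 := by simpa using hb
  rw [Quaternion.normSq_def'] at hn
  simp only [Quaternion.ext_iff, Quaternion.re_mul, Quaternion.imI_mul, Quaternion.imJ_mul,
    Quaternion.imK_mul, Quaternion.re_neg, Quaternion.imI_neg, Quaternion.imJ_neg,
    Quaternion.imK_neg] at h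
  obtain ⟨h0, h1, h2, h3⟩ := h
  refine (mul_eq_zero.mp ?_).resolve_left hn
  linear_combination (b.re * h0 + b.imI * h1 + b.imJ * h2 + b.imK * h3) / 2

/-- A quaternion commuting with two nonzero anticommuting quaternions is real. -/
theorem Quaternion.eq_coe_re_of_comm_of_anticomm {a b d : Quaternion ℝ} (hb : b ≠ 0) (hd : d ≠ 0)
    (hab : a * b = b * a) (had : a * d = d * a) (hbd : b * d = -(d * b)) :
    a = (a.re : Quaternion ℝ) := by
  have hd0 := Quaternion.re_eq_zero_of_anticomm hb hbd
  have hb0 := Quaternion.re_eq_zero_of_anticomm hd (by rw [hbd, neg_neg] : d * b = -(b * d))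
  have hnb : Quaternion.normSq b ≠ 0 := by simpa using hb
  have hnd : Quaternion.normSq d ≠ 0 := by simpa using hd
  rw [Quaternion.normSq_def', hb0] at hnb
  rw [Quaternion.normSq_def', hd0] at hnd
  simp only [Quaternion.ext_iff, Quaternion.re_mul, Quaternion.imI_mul, Quaternion.imJ_mul,
    Quaternion.imK_mul, Quaternion.re_neg, hb0, hd0] at hab had hbd
  obtain ⟨-, p1, p2, p3⟩ := hab
  obtain ⟨-, q1, q2, q3⟩ := had
  have r := hbd.1
  have dot : a.imI * d.imI + a.imJ * d.imJ + a.imK * d.imK = 0 := by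
    refine (mul_eq_zero.mp ?_).resolve_left hnb
    linear_combination
      ((b.imK * d.imJ - b.imJ * d.imK) * p1 + (b.imI * d.imK - b.imK * d.imI) * p2 +
        (b.imJ * d.imI - b.imI * d.imJ) * p3) / 2
        - (a.imI * b.imI + a.imJ * b.imJ + a.imK * b.imK) * r / 2
  ext
  · simp
  · refine (mul_eq_zero.mp ?_).resolve_left hnd
    linear_combination d.imI * dot + (d.imJ * q3 - d.imK * q2) / 2
  · refine (mul_eq_zero.mp ?_).resolve_left hnd
    linear_combination d.imJ * dot + (d.imK * q1 - d.imI * q3) / 2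
  · refine (mul_eq_zero.mp ?_).resolve_left hnd
    linear_combination d.imK * dot + (d.imI * q2 - d.imJ * q1) / 2

theorem IsObstruction.exists_lifts {V : Type*} {K : SimpleGraph V} {x : V → SO3}
    {Λ : Sym2 V → ℤˣ} (h : IsObstruction K x Λ) {v w : V} (hvw : K.Adj v w) :
    ∃ q p : Quaternion ℝ, q ≠ 0 ∧ p ≠ 0 ∧ QuatLift q (x v).1 ∧ QuatLift p (x w).1 ∧
      q * p = ((Λ s(v, w) : ℤ) : Quaternion ℝ) * (p * q) := by
  obtain ⟨q, p, hq, hp, hqx, hpx, e⟩ := h v w hvw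
  have hq0 : q ≠ 0 := norm_ne_zero_iff.mp (by simp [hq])
  have hp0 : p ≠ 0 := norm_ne_zero_iff.mp (by simp [hp])
  refine ⟨q, p, hq0, hp0, hqx, hpx, ?_⟩
  rw [← e]
  simp only [mul_assoc, inv_mul_cancel_left₀ hp0, inv_mul_cancel₀ hq0, mul_one]

theorem IsObstruction.mul_eq {V : Type*} {K : SimpleGraph V} {x : V → SO3}
    {Λ : Sym2 V → ℤˣ} (h : IsObstruction K x Λ) {v w : V} (hvw : K.Adj v w)
    {q p : Quaternion ℝ} (hq0 : q ≠ 0) (hp0 : p ≠ 0)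
    (hq : QuatLift q (x v).1) (hp : QuatLift p (x w).1) :
    q * p = ((Λ s(v, w) : ℤ) : Quaternion ℝ) * (p * q) := by
  obtain ⟨q', p', hq1, hp1, hq', hp', e⟩ := h.exists_lifts hvw
  obtain ⟨r, -, rfl⟩ := hq.eq_smul hq' hq0 hq1
  obtain ⟨s, -, rfl⟩ := hp.eq_smul hp' hp0 hp1
  simp only [smul_mul_assoc, mul_smul_comm, e]
  rw [smul_comm]

open Classical in
/-- If the obstruction map is surjective, a vertex of a triangle has no neighbour outside it. -/
theorem eq_or_eq_of_adj_of_triangle {V : Type*} {K : SimpleGraph V}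
    (hsurj : ∀ Λ : Sym2 V → ℤˣ, ∃ x : V → SO3, x ∈ RepVar K ∧ IsObstruction K x Λ)
    {a b d e : V} (hab : K.Adj a b) (hbd : K.Adj b d) (hda : K.Adj d a) (hae : K.Adj a e) :
    e = b ∨ e = d := by
  by_contra! hne
  obtain ⟨x, -, hx⟩ := hsurj fun s => if s = s(b, d) ∨ s = s(a, e) then -1 else 1
  obtain ⟨A, B, hA0, hB0, hA, hB, hAB⟩ := hx.exists_lifts hab
  obtain ⟨D, -, hD0, -, hD, -, -⟩ := hx.exists_lifts hda
  obtain ⟨-, E, -, hE0, -, hE, -⟩ := hx.exists_lifts hae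
  have hAD := hx.mul_eq hda.symm hA0 hD0 hA hD
  have hBD := hx.mul_eq hbd hB0 hD0 hB hD
  have hAE := hx.mul_eq hae hA0 hE0 hA hE
  simp only [Sym2.eq_iff, hab.ne, hab.ne', hda.ne, hda.ne', hae.ne, hne.1.symm, hne.2.symm,
    or_true, and_false, false_and, and_true, or_false, if_true, if_false,
    Units.val_one, Units.val_neg, Int.cast_one, Int.cast_neg, one_mul, neg_mul] at hAB hAD hBD hAE
  have hAre := Quaternion.eq_coe_re_of_comm_of_anticomm hB0 hD0 hAB hAD hBD
  have hcomm : A * E = E * A := by rw [hAre]; exact Quaternion.coe_commutes _ _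
  rw [hcomm] at hAE
  have h2 : (2 : ℝ) • (E * A) = 0 := by rw [two_smul, ← eq_neg_iff_add_eq_zero, ← hAE]
  exact mul_ne_zero hE0 hA0 ((smul_eq_zero.mp h2).resolve_left two_ne_zero)

theorem no_triangle_of_obstruction_surjective
    {V : Type} [Fintype V] (K : SimpleGraph V)
    (hsurj : ∀ Λ : Sym2 V → ℤˣ, ∃ x : V → SO3, x ∈ RepVar K ∧ IsObstruction K x Λ)
    (c : K.ConnectedComponent)
    (hc : ¬ ∃ n : ℕ, 3 ≤ n ∧ Nonempty (K.induce c.supp ≃g SimpleGraph.cycleGraph n)) :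
    ¬ ∃ a b d : V, a ∈ c.supp ∧ K.Adj a b ∧ K.Adj b d ∧ K.Adj d a := by
  rintro ⟨a, b, d, ha, hab, hbd, hda⟩
  have closed : ∀ v w, (v = a ∨ v = b ∨ v = d) → K.Adj v w → (w = a ∨ w = b ∨ w = d) := by
    rintro v w (rfl | rfl | rfl) hvw
    · exact Or.inr (eq_or_eq_of_adj_of_triangle hsurj hab hbd hda hvw)
    · have := eq_or_eq_of_adj_of_triangle hsurj hbd hda hab hvw
      tauto
    · have := eq_or_eq_of_adj_of_triangle hsurj hda hab hbd hvw
      tauto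
  have walk : ∀ v w, K.Walk v w → (v = a ∨ v = b ∨ v = d) → (w = a ∨ w = b ∨ w = d) := by
    intro v w p
    induction p with
    | nil => exact id
    | cons h _ ih => exact fun hv => ih (closed _ _ hv h)
  have hsupp : c.supp = {a, b, d} := by
    have hb : b ∈ c.supp := c.mem_supp_of_adj_mem_supp ha hab
    have hd : d ∈ c.supp := c.mem_supp_of_adj_mem_supp hb hbd
    ext w
    constructor
    · intro hw
      obtain ⟨p⟩ := SimpleGraph.ConnectedComponent.exact
        ((SimpleGraph.ConnectedComponent.mem_supp_iff _ _).mp ha |>.trans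
          ((SimpleGraph.ConnectedComponent.mem_supp_iff _ _).mp hw).symm)
      exact walk _ _ p (Or.inl rfl)
    · rintro (rfl | rfl | rfl) <;> assumption
  have hcard : Nat.card c.supp = 3 := by
    rw [Nat.card_coe_set_eq, hsupp]
    exact Set.ncard_eq_three.mpr ⟨a, b, d, hab.ne, hda.ne', hbd.ne, rfl⟩
  have htop : K.induce c.supp = ⊤ := by
    ext ⟨v, hv⟩ ⟨w, hw⟩
    simp only [SimpleGraph.comap_adj, SimpleGraph.top_adj, Function.Embedding.subtype_apply,
      ne_eq, Subtype.mk.injEq]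
    rw [hsupp] at hv hw
    refine ⟨SimpleGraph.Adj.ne, fun hvw => ?_⟩
    rcases hv with rfl | rfl | rfl <;> rcases hw with rfl | rfl | rfl <;>
      first | exact absurd rfl hvw | assumption | (apply SimpleGraph.Adj.symm; assumption)
  refine hc ⟨3, le_rfl, ?_⟩
  rw [htop, SimpleGraph.cycleGraph_three_eq_top]
  exact ⟨SimpleGraph.Iso.completeGraph (Finite.equivFinOfCardEq hcard)⟩

end
end

section
/- For every n ≥ 1, the special unitary group SU(n) of n×n complex matrices, with its subspace topology, satisfies Property A. -/
/-- A topological group `G` satisfies **Property A** if for every finite subset `S ⊆ G`,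
every connected component of the centralizer `C_G(S)` (with the subspace topology)
contains an element of the center `Z(G)`. -/
def HasPropertyA (G : Type*) [Group G] [TopologicalSpace G] : Prop :=
  ∀ S : Finset G, ∀ g : Subgroup.centralizer (S : Set G),
    ∃ z : Subgroup.centralizer (S : Set G),
      (z : G) ∈ Subgroup.center G ∧ z ∈ connectedComponent g

/-- The special unitary group `SU(n)`, realized as the subgroup of the unitary group
`U(n)` consisting of matrices of determinant `1`. -/
def SU (n : ℕ) : Subgroup (Matrix.unitaryGroup (Fin n) ℂ) where
  carrier := {A | (A : Matrix (Fin n) (Fin n) ℂ).det = 1}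
  one_mem' := by simp
  mul_mem' := by
    intro a b ha hb
    simp only [Set.mem_setOf_eq, Submonoid.coe_mul, Matrix.det_mul] at *
    rw [ha, hb, mul_one]
  inv_mem' := by
    intro a ha
    simp only [Set.mem_setOf_eq] at *
    rw [Matrix.UnitaryGroup.inv_val]
    show (↑a : Matrix (Fin n) (Fin n) ℂ).conjTranspose.det = 1
    rw [Matrix.det_conjTranspose, ha, star_one]

open scoped Matrix.Norms.L2Operator in
/-- Every unitary matrix is `exp (i H)` for a Hermitian matrix `H` which commutes with every unitary
matrix that commutes with the given one. -/
theorem exists_isHermitian_exp_eq {ι : Type*} [Fintype ι] [DecidableEq ι]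
    (u : Matrix.unitaryGroup ι ℂ) :
    ∃ H : Matrix ι ι ℂ, H.IsHermitian ∧ NormedSpace.exp (Complex.I • H) = u ∧
      ∀ b : Matrix.unitaryGroup ι ℂ, Commute b u → Commute (b : Matrix ι ι ℂ) H := by
  have hcont (f : ℂ → ℂ) : ContinuousOn f (spectrum ℂ (u : Matrix ι ι ℂ)) :=
    (Matrix.finite_spectrum _).continuousOn f
  have hnormal : IsStarNormal (u : Matrix ι ι ℂ) := Unitary.coe_isStarNormal u
  have hH : IsSelfAdjoint (cfc (fun z : ℂ => (z.arg : ℂ)) (u : Matrix ι ι ℂ)) := by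
    rw [IsSelfAdjoint, ← cfc_star]
    exact cfc_congr fun z _ => Complex.conj_ofReal _
  refine ⟨_, hH, ?_, fun b hb => ?_⟩
  · rw [← CFC.exp_eq_normedSpace_exp (𝕜 := ℂ) (by cfc_tac),
      ← cfc_smul _ _ _ (hcont _),
      ← cfc_comp' _ _ _ (by rw [← Complex.exp_eq_exp_ℂ]; fun_prop) (hcont _)]
    conv_rhs => rw [← cfc_id' ℂ (u : Matrix ι ι ℂ)]
    refine cfc_congr fun z hz => ?_
    have hz1 : ‖z‖ = 1 := by simpa using spectrum.subset_circle_of_unitary u.2 hz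
    have := Complex.norm_mul_exp_arg_mul_I z
    rw [hz1] at this
    rw [← Complex.exp_eq_exp_ℂ, smul_eq_mul, mul_comm]
    simpa using this
  · have h1 : Commute (u : Matrix ι ι ℂ) b := (congrArg Subtype.val hb.eq).symm
    have h2 : Commute (star (u : Matrix ι ι ℂ)) b := by
      have : Commute u⁻¹ b := hb.symm.inv_left
      exact congrArg Subtype.val this.eq
    exact (Commute.cfc h1 h2 _).symm

/-- For Hermitian `H`, `det (exp (i H)) = exp (i tr H)`. -/
theorem Matrix.IsHermitian.det_exp_I_smul {ι : Type*} [Fintype ι] [DecidableEq ι]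
    {H : Matrix ι ι ℂ} (hH : H.IsHermitian) :
    (NormedSpace.exp (Complex.I • H)).det = Complex.exp (Complex.I * H.trace) := by
  set V := hH.eigenvectorUnitary
  have hV : (V : Matrix ι ι ℂ) * star (V : Matrix ι ι ℂ) = 1 := Unitary.coe_mul_star_self V
  have hinv : (V : Matrix ι ι ℂ)⁻¹ = star (V : Matrix ι ι ℂ) := Matrix.inv_eq_right_inv hV
  have hunit : IsUnit (V : Matrix ι ι ℂ) := Unitary.isUnit_coe
  have hspec : Complex.I • H = (V : Matrix ι ι ℂ) *
      Matrix.diagonal (fun i => Complex.I * (hH.eigenvalues i : ℂ)) * (V : Matrix ι ι ℂ)⁻¹ := by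
    conv_lhs => rw [hH.spectral_theorem, Unitary.conjStarAlgAut_apply]
    rw [hinv, ← Matrix.smul_mul, ← Matrix.mul_smul, ← Matrix.diagonal_smul]
    rfl
  rw [hspec, Matrix.exp_conj _ _ hunit, Matrix.det_conj hunit, Matrix.exp_diagonal,
    Matrix.det_diagonal, hH.trace_eq_sum_eigenvalues, Finset.mul_sum, Complex.exp_sum]
  simp [Pi.coe_exp, Complex.exp_eq_exp_ℂ]

open scoped Matrix.Norms.L2Operator in
theorem Matrix.IsHermitian.exp_I_smul_mem_unitaryGroup {ι : Type*} [Fintype ι] [DecidableEq ι]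
    {H : Matrix ι ι ℂ} (hH : H.IsHermitian) :
    NormedSpace.exp (Complex.I • H) ∈ Matrix.unitaryGroup ι ℂ :=
  (selfAdjoint.expUnitary ⟨H, hH⟩).2

open scoped Matrix.Norms.L2Operator in
theorem Matrix.continuous_exp {ι : Type*} [Fintype ι] [DecidableEq ι] :
    Continuous (NormedSpace.exp : Matrix ι ι ℂ → Matrix ι ι ℂ) :=
  letI : NormedAlgebra ℚ (Matrix ι ι ℂ) := .restrictScalars ℚ ℂ _
  NormedSpace.exp_continuous

open scoped Matrix.Norms.L2Operator in
theorem Matrix.commute_exp_I_smul {ι : Type*} [Fintype ι] [DecidableEq ι] {B H : Matrix ι ι ℂ}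
    (h : Commute B H) : Commute B (NormedSpace.exp (Complex.I • H)) :=
  letI : NormedAlgebra ℚ (Matrix ι ι ℂ) := .restrictScalars ℚ ℂ _
  (h.smul_right Complex.I).exp_right

theorem su_hasPropertyA (n : ℕ) (hn : 1 ≤ n) : HasPropertyA (SU n) := by
  intro S g
  obtain ⟨H, hH, hexp, hcomm⟩ := exists_isHermitian_exp_eq (g : SU n).1
  have hdet := hH.det_exp_I_smul
  rw [hexp, show ((g : SU n).1 : Matrix (Fin n) (Fin n) ℂ).det = 1 from (g : SU n).2] at hdet
  obtain ⟨k, hk⟩ := Complex.exp_eq_one_iff.mp hdet.symm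
  have htrace : H.trace = k * (2 * Real.pi) := by
    refine mul_left_cancel₀ Complex.I_ne_zero ?_
    rw [hk]; ring
  have hn0 : (n : ℂ) ≠ 0 := by exact_mod_cast (by omega : n ≠ 0)
  let c : ℝ := k * (2 * Real.pi) / n
  let K : ℝ → Matrix (Fin n) (Fin n) ℂ := fun t => ((1 - t : ℝ) : ℂ) • H + ((t * c : ℝ) : ℂ) • 1
  have hreal (r : ℝ) : IsSelfAdjoint (r : ℂ) := Complex.conj_ofReal r
  have hK (t : ℝ) : (K t).IsHermitian :=
    (IsSelfAdjoint.smul (hreal _) hH).add (IsSelfAdjoint.smul (hreal _) (.one _))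
  have hKtrace (t : ℝ) : (K t).trace = H.trace := by
    simp only [K, c, Matrix.trace_add, Matrix.trace_smul, Matrix.trace_one, htrace, smul_eq_mul,
      Fintype.card_fin]
    push_cast
    field_simp
    ring
  have hKcont : Continuous K := by fun_prop
  let f : ℝ → SU n := fun t => ⟨⟨_, (hK t).exp_I_smul_mem_unitaryGroup⟩, by
    change (NormedSpace.exp (Complex.I • K t)).det = 1
    rw [(hK t).det_exp_I_smul, hKtrace, ← hdet]⟩
  have hf (t : ℝ) : f t ∈ Subgroup.centralizer (S : Set (SU n)) := by
    refine Subgroup.mem_centralizer_iff.mpr fun s hs => ?_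
    have hsg : Commute s.1 (g : SU n).1 :=
      congrArg Subtype.val (Subgroup.mem_centralizer_iff.mp g.2 s hs)
    have hsK : Commute (s.1 : Matrix (Fin n) (Fin n) ℂ) (K t) :=
      ((hcomm _ hsg).smul_right _).add_right ((Commute.one_right _).smul_right _)
    exact Subtype.ext (Subtype.ext (Matrix.commute_exp_I_smul hsK).eq)
  have hf0 : (⟨f 0, hf 0⟩ : Subgroup.centralizer (S : Set (SU n))) = g := by
    refine Subtype.ext (Subtype.ext (Subtype.ext ?_))
    simpa [f, K] using hexp
  have hfcont : Continuous fun t => (⟨f t, hf t⟩ : Subgroup.centralizer (S : Set (SU n))) :=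
    (((Matrix.continuous_exp.comp (hKcont.const_smul Complex.I)).subtype_mk _).subtype_mk
      _).subtype_mk _
  refine ⟨⟨f 1, hf 1⟩, Subgroup.mem_center_iff.mpr fun a => ?_, ?_⟩
  · have haK : Commute (a.1 : Matrix (Fin n) (Fin n) ℂ) (K 1) := by
      simpa [K] using (Commute.one_right (a.1 : Matrix (Fin n) (Fin n) ℂ)).smul_right (c : ℂ)
    exact Subtype.ext (Subtype.ext (Matrix.commute_exp_I_smul haK).eq)
  · exact (isPreconnected_range hfcont).subset_connectedComponent ⟨0, hf0⟩ ⟨1, rfl⟩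
end

section
/- The group Sp(1) of unit quaternions {q ∈ ℍ : q q̄ = 1}, with its subspace topology from ℍ, satisfies Property A. -/
/-- The segment from a unit quaternion `q ≠ -1` to `1` avoids the origin. -/
theorem Quaternion.segment_to_one_ne_zero {q : Quaternion ℝ} (hq : ‖q‖ = 1) (hne : q ≠ -1)
    {t : ℝ} (ht0 : 0 ≤ t) (ht1 : t ≤ 1) : (1 - t) • q + t • (1 : Quaternion ℝ) ≠ 0 := by
  intro h
  have h1 : (1 - t) • q = -(t • (1 : Quaternion ℝ)) := eq_neg_of_add_eq_zero_left h
  have h2 := congrArg norm h1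
  rw [norm_neg, norm_smul, norm_smul, hq, norm_one, Real.norm_of_nonneg (by linarith),
    Real.norm_of_nonneg ht0] at h2
  have h3 : 1 - t = t := by linarith
  have h4 : t ≠ 0 := by
    rintro rfl
    norm_num at h3
  rw [h3, ← smul_neg] at h1
  exact hne (smul_right_injective _ h4 h1)

theorem Quaternion.mem_unitary_of_norm_eq_one {q : Quaternion ℝ} (hq : ‖q‖ = 1) :
    q ∈ unitary (Quaternion ℝ) := by
  have h : Quaternion.normSq q = 1 := by rw [Quaternion.normSq_eq_norm_mul_self, hq, mul_one]
  rw [Unitary.mem_iff, Quaternion.star_mul_self, Quaternion.self_mul_star, h]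
  simp

/-- `Sp(1)`, the group of unit quaternions `{q : q * q̄ = 1}`, with the subspace
topology from `ℍ`. -/
theorem sp1_hasPropertyA : HasPropertyA (unitary (Quaternion ℝ)) := by
  intro S g
  have hg : ‖((g : unitary (Quaternion ℝ)) : Quaternion ℝ)‖ = 1 :=
    CStarRing.norm_coe_unitary _
  by_cases hne : ((g : unitary (Quaternion ℝ)) : Quaternion ℝ) = -1
  · refine ⟨g, ?_, mem_connectedComponent⟩
    rw [Subgroup.mem_center_iff]
    intro h
    ext1
    simp [hne]
  · let p : unitInterval → Quaternion ℝ := fun t =>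
      (1 - (t : ℝ)) • ((g : unitary (Quaternion ℝ)) : Quaternion ℝ) + (t : ℝ) • 1
    have hp0 : ∀ t, p t ≠ 0 := fun t =>
      Quaternion.segment_to_one_ne_zero hg hne t.2.1 t.2.2
    have hp : Continuous p := by fun_prop
    have hmem : ∀ t, ‖p t‖⁻¹ • p t ∈ unitary (Quaternion ℝ) := fun t =>
      Quaternion.mem_unitary_of_norm_eq_one (norm_smul_inv_norm (𝕜 := ℝ) (hp0 t))
    have hcent : ∀ t, (⟨‖p t‖⁻¹ • p t, hmem t⟩ : unitary (Quaternion ℝ)) ∈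
        Subgroup.centralizer (S : Set (unitary (Quaternion ℝ))) := by
      intro t
      rw [Subgroup.mem_centralizer_iff]
      intro s hs
      have hsg : Commute (s : Quaternion ℝ) ((g : unitary (Quaternion ℝ)) : Quaternion ℝ) :=
        congrArg Subtype.val (Subgroup.mem_centralizer_iff.1 g.2 s hs)
      ext1
      exact (((hsg.smul_right _).add_right ((Commute.one_right _).smul_right _)).smul_right _).eq
    let f : unitInterval → Subgroup.centralizer (S : Set (unitary (Quaternion ℝ))) :=
      fun t => ⟨⟨‖p t‖⁻¹ • p t, hmem t⟩, hcent t⟩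
    have hf : Continuous f :=
      (((hp.norm.inv₀ fun t => norm_ne_zero_iff.2 (hp0 t)).smul hp).subtype_mk hmem).subtype_mk
        hcent
    have hf0 : f 0 = g := by
      ext1
      ext1
      simp [f, p, hg]
    have hf1 : f 1 = 1 := by
      ext1
      ext1
      simp [f, p]
    refine ⟨1, one_mem _, ?_⟩
    exact (isPreconnected_range hf).subset_connectedComponent ⟨0, hf0⟩ ⟨1, hf1⟩
end

section
/- For every n ≥ 3, the special orthogonal group SO(n) of n×n real matrices, with its subspace topology, does not satisfy Property A. -/
/-- The special orthogonal group `SO(n)`: the subgroup of the (real) orthogonal group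
`O(n) = {M : M * Mᵀ = 1}` consisting of matrices of determinant `1`. -/
def SO (n : ℕ) : Subgroup (Matrix.unitaryGroup (Fin n) ℝ) where
  carrier := {A | (A : Matrix (Fin n) (Fin n) ℝ).det = 1}
  one_mem' := by simp
  mul_mem' := by
    intro a b ha hb
    simp only [Set.mem_setOf_eq, Submonoid.coe_mul, Matrix.det_mul] at *
    rw [ha, hb, mul_one]
  inv_mem' := by
    intro a ha
    simp only [Set.mem_setOf_eq] at *
    rw [Matrix.UnitaryGroup.inv_val]
    show (↑a : Matrix (Fin n) (Fin n) ℝ).conjTranspose.det = 1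
    rw [Matrix.det_conjTranspose, ha, star_one]

namespace SO

variable {n : ℕ}

/-- An orthogonal matrix of determinant one as an element of `SO n`. -/
def ofMatrix (M : Matrix (Fin n) (Fin n) ℝ) (h : M * M.transpose = 1) (hd : M.det = 1) : SO n :=
  ⟨⟨M, Matrix.mem_unitaryGroup_iff.2 (by
    rwa [Matrix.star_eq_conjTranspose, Matrix.conjTranspose_eq_transpose_of_trivial])⟩, hd⟩

/-- The underlying matrix of an element of `SO n`. -/
def toMatrix (g : SO n) : Matrix (Fin n) (Fin n) ℝ := g.1.1

lemma toMatrix_mul (g h : SO n) : toMatrix (g * h) = toMatrix g * toMatrix h := rfl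

lemma continuous_toMatrix_apply (i j : Fin n) : Continuous fun g : SO n => toMatrix g i j :=
  (continuous_subtype_val.comp continuous_subtype_val).matrix_elem i j

lemma sum_sq_row (g : SO n) (i : Fin n) : ∑ j, toMatrix g i j ^ 2 = 1 := by
  have h := congrFun (congrFun (Matrix.mem_unitaryGroup_iff.1 g.1.2) i) i
  simpa [Matrix.mul_apply, Matrix.star_apply, toMatrix, sq] using h

/-- The diagonal entries of the reflection in the coordinates `a` and `b`. -/
def signs (a b : Fin n) (i : Fin n) : ℝ :=
  (if i = a then -1 else 1) * (if i = b then -1 else 1)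

lemma signs_ne_or_signs_ne {a b c i j : Fin n} (hab : a ≠ b) (hac : a ≠ c) (hbc : b ≠ c)
    (hi : i = b ∨ i = c) (hij : j ≠ i) :
    signs a b i ≠ signs a b j ∨ signs b c i ≠ signs b c j := by
  unfold signs
  grind

/-- The diagonal matrix in `SO n` changing the signs of the coordinates `a` and `b`. -/
def flip (a b : Fin n) : SO n :=
  ofMatrix (Matrix.diagonal (signs a b))
    (by
      rw [Matrix.diagonal_transpose, Matrix.diagonal_mul_diagonal, ← Matrix.diagonal_one]
      congr 1
      funext i
      unfold signs
      split_ifs <;> norm_num)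
    (by
      rw [Matrix.det_diagonal]
      unfold signs
      simp only [Finset.prod_mul_distrib, Finset.prod_ite_eq', Finset.mem_univ, if_true]
      norm_num)

lemma toMatrix_flip (a b : Fin n) : toMatrix (flip a b) = Matrix.diagonal (signs a b) := rfl

/-- The permutation matrix of an even permutation. -/
def ofPerm (σ : Equiv.Perm (Fin n)) (h : Equiv.Perm.sign σ = 1) : SO n :=
  ofMatrix (σ.permMatrix ℝ)
    (by rw [Matrix.transpose_permMatrix, ← Matrix.permMatrix_mul]; simp)
    (by rw [Matrix.det_permutation, h]; simp)

lemma toMatrix_ofPerm_apply (σ : Equiv.Perm (Fin n)) (h : Equiv.Perm.sign σ = 1) (i j : Fin n) :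
    toMatrix (ofPerm σ h) i j = if σ i = j then 1 else 0 := by
  simp [toMatrix, ofPerm, ofMatrix, Equiv.Perm.permMatrix, PEquiv.toMatrix_apply, eq_comm]

lemma toMatrix_apply_eq_zero_of_commute_flip {g : SO n} {a b i j : Fin n}
    (h : flip a b * g = g * flip a b) (hij : signs a b i ≠ signs a b j) :
    toMatrix g i j = 0 := by
  have h' := congrFun (congrFun (congrArg toMatrix h) i) j
  rw [toMatrix_mul, toMatrix_mul, toMatrix_flip, Matrix.diagonal_mul, Matrix.mul_diagonal] at h'
  have : (signs a b i - signs a b j) * toMatrix g i j = 0 := by linarith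
  exact (mul_eq_zero.1 this).resolve_left (sub_ne_zero.2 hij)

lemma toMatrix_self_eq_one_or_neg_one {g : SO n} {i : Fin n}
    (h : ∀ j, j ≠ i → toMatrix g i j = 0) : toMatrix g i i = 1 ∨ toMatrix g i i = -1 := by
  have h1 := sum_sq_row g i
  rw [Finset.sum_eq_single i (fun j _ hj => by rw [h j hj]; norm_num) (by simp)] at h1
  simpa using h1

end SO

theorem so_not_hasPropertyA (n : ℕ) (hn : 3 ≤ n) : ¬ HasPropertyA (SO n) := by
  classical
  intro H
  let a : Fin n := ⟨0, by omega⟩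
  let b : Fin n := ⟨1, by omega⟩
  let c : Fin n := ⟨2, by omega⟩
  have hab : a ≠ b := by simp [a, b]
  have hac : a ≠ c := by simp [a, c]
  have hbc : b ≠ c := by simp [b, c]
  let S : Finset (SO n) := {SO.flip a b, SO.flip b c}
  have hS (g : SO n) (hg : g ∈ Subgroup.centralizer (S : Set (SO n))) (i j : Fin n)
      (hij : SO.signs a b i ≠ SO.signs a b j ∨ SO.signs b c i ≠ SO.signs b c j) :
      SO.toMatrix g i j = 0 := by
    rw [Subgroup.mem_centralizer_iff] at hg
    rcases hij with hij | hij
    · exact SO.toMatrix_apply_eq_zero_of_commute_flip (hg _ (by simp [S])) hij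
    · exact SO.toMatrix_apply_eq_zero_of_commute_flip (hg _ (by simp [S])) hij
  have hsep (i j : Fin n) (hi : i = b ∨ i = c) (hij : j ≠ i) :
      SO.signs a b i ≠ SO.signs a b j ∨ SO.signs b c i ≠ SO.signs b c j :=
    SO.signs_ne_or_signs_ne hab hac hbc hi hij
  have hconst (g z : Subgroup.centralizer (S : Set (SO n))) (hz : z ∈ connectedComponent g)
      (i : Fin n) (hi : i = b ∨ i = c) : SO.toMatrix z.1 i i = SO.toMatrix g.1 i i := by
    have hmaps : Set.MapsTo (fun x : Subgroup.centralizer (S : Set (SO n)) =>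
        SO.toMatrix x.1 i i) (connectedComponent g) ({1, -1} : Set ℝ) := fun x _ =>
      SO.toMatrix_self_eq_one_or_neg_one fun j hj => hS x.1 x.2 i j (hsep i j hi hj)
    exact isPreconnected_connectedComponent.constant_of_mapsTo
      (Set.toFinite _).isDiscrete ((SO.continuous_toMatrix_apply i i).comp continuous_subtype_val).continuousOn
      hmaps hz mem_connectedComponent
  have hmem : SO.flip a b ∈ Subgroup.centralizer (S : Set (SO n)) := by
    rw [Subgroup.mem_centralizer_iff]
    intro h hh
    obtain rfl | rfl : h = SO.flip a b ∨ h = SO.flip b c := by simpa [S] using hh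
    · rfl
    · apply Subtype.ext
      apply Subtype.ext
      change SO.toMatrix _ * SO.toMatrix _ = SO.toMatrix _ * SO.toMatrix _
      simp only [SO.toMatrix_flip, Matrix.diagonal_mul_diagonal, mul_comm]
  obtain ⟨z, hzc, hz⟩ := H S ⟨_, hmem⟩
  have hzb := hconst _ z hz b (Or.inl rfl)
  have hzcc := hconst _ z hz c (Or.inr rfl)
  rw [SO.toMatrix_flip, Matrix.diagonal_apply_eq, SO.signs] at hzb hzcc
  rw [if_neg hab.symm, if_pos rfl] at hzb
  rw [if_neg hac.symm, if_neg hbc.symm] at hzcc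
  let σ : Equiv.Perm (Fin n) := Equiv.swap a c * Equiv.swap a b
  have hσ : Equiv.Perm.sign σ = 1 := by
    simp [σ, Equiv.Perm.sign_swap hab, Equiv.Perm.sign_swap hac]
  have hσb : σ b = c := by simp [σ]
  have hcomm := congrFun (congrFun (congrArg SO.toMatrix
    (Subgroup.mem_center_iff.1 hzc (SO.ofPerm σ hσ))) b) c
  rw [SO.toMatrix_mul, SO.toMatrix_mul, Matrix.mul_apply, Matrix.mul_apply,
    Finset.sum_eq_single c
      (fun j _ hj => by
        rw [hS z.1 z.2 j c ((hsep c j (Or.inr rfl) hj).imp Ne.symm Ne.symm), mul_zero])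
      (by simp),
    Finset.sum_eq_single b
      (fun j _ hj => by rw [hS z.1 z.2 b j (hsep b j (Or.inl rfl) hj), zero_mul]) (by simp),
    SO.toMatrix_ofPerm_apply, if_pos hσb, hzb, hzcc] at hcomm
  norm_num at hcomm
end

section
/- Let a and b be unit quaternions. Then the commutator [a, b] = a b a⁻¹ b⁻¹ equals −1 if and only if a and b are both purely imaginary (Re(a) = Re(b) = 0) and a is orthogonal to b, i.e., Re(a b̄) = 0. -/
namespace Quaternion

theorem re_eq_zero_of_mul_eq_neg_mul {a b : Quaternion ℝ} (hb : b ≠ 0)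
    (h : a * b = -(b * a)) : a.re = 0 := by
  have h₀ := congrArg QuaternionAlgebra.re h
  have h₁ := congrArg QuaternionAlgebra.imI h
  have h₂ := congrArg QuaternionAlgebra.imJ h
  have h₃ := congrArg QuaternionAlgebra.imK h
  simp only [re_neg, imI_neg, imJ_neg, imK_neg, re_mul, imI_mul, imJ_mul, imK_mul] at h₀ h₁ h₂ h₃
  have key : a.re * normSq b = 0 := by
    rw [normSq_def']
    linear_combination (b.re * h₀ + b.imI * h₁ + b.imJ * h₂ + b.imK * h₃) / 2
  exact (mul_eq_zero.mp key).resolve_right (normSq_ne_zero.mpr hb)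

theorem mul_eq_neg_mul_iff {a b : Quaternion ℝ} (ha : a ≠ 0) (hb : b ≠ 0) :
    a * b = -(b * a) ↔ a.re = 0 ∧ b.re = 0 ∧ (a * star b).re = 0 := by
  constructor
  · intro h
    have hare := re_eq_zero_of_mul_eq_neg_mul hb h
    have hbre := re_eq_zero_of_mul_eq_neg_mul ha (by rw [h, neg_neg] : b * a = -(a * b))
    refine ⟨hare, hbre, ?_⟩
    have h₀ := congrArg QuaternionAlgebra.re h
    simp only [re_neg, re_mul, re_star, imI_star, imJ_star, imK_star, hare, hbre] at h₀ ⊢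
    linarith
  · rintro ⟨hare, hbre, h⟩
    simp only [re_mul, re_star, imI_star, imJ_star, imK_star, hare, hbre] at h
    apply Quaternion.ext <;>
      simp only [re_neg, imI_neg, imJ_neg, imK_neg, re_mul, imI_mul, imJ_mul, imK_mul,
        hare, hbre] <;>
      linarith

end Quaternion

theorem unit_quaternion_commutator_eq_neg_one_iff
    (a b : Quaternion ℝ) (ha : ‖a‖ = 1) (hb : ‖b‖ = 1) :
    a * b * a⁻¹ * b⁻¹ = -1 ↔
      a.re = 0 ∧ b.re = 0 ∧ (a * star b).re = 0 := by
  have ha₀ : a ≠ 0 := norm_ne_zero_iff.mp (by simp [ha])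
  have hb₀ : b ≠ 0 := norm_ne_zero_iff.mp (by simp [hb])
  rw [← Quaternion.mul_eq_neg_mul_iff ha₀ hb₀, mul_inv_eq_iff_eq_mul₀ hb₀,
    mul_inv_eq_iff_eq_mul₀ ha₀, neg_one_mul, neg_mul]
end
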